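/- Fix θ > 0, an integer N ≥ 1, a = (a_1 > ⋯ > a_N) ∈ 𝒫_N, and y ∈ ℂ with Re y > 0. Fix any M > a_1 and r > 0 and let C be the counter-clockwise oriented contour consisting of the vertical segment from M − ri to M + ri together with the two horizontal rays from −∞ − ri to M − ri and from M + ri to −∞ + ri. Then the contour integral below converges absolutely and 𝓑_a(y, 0^{N−1}; θ) = ( Γ(θN) / y^{θN−1} ) · (1/(2πi)) ∫_C exp(yz) ∏_{i=1}^N (z − a_i)^{−θ} dz, where (z − a_i)^{−θ} := exp(−θ Log(z − a_i)) with Log the principal branch of the logarithm on ℂ ∖ (−∞, 0]. -/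

import Mathlib

open MeasureTheory Filter Topology
open scoped ENNReal

noncomputable section

/-- A triangular array with `M` levels: for `k : Fin M`, level `k+1` has `k+1` real entries. -/
abbrev Tri (M : ℕ) := ∀ k : Fin M, Fin (k.1 + 1) → ℝ

/-- `Interlaces u v` means `u ≺ v`, i.e. `v 1 > u 1 > v 2 > u 2 > ⋯ > v n > u n > v (n+1)`. -/
def Interlaces {n : ℕ} (u : Fin n → ℝ) (v : Fin (n + 1) → ℝ) : Prop :=
  ∀ i : Fin n, u i < v i.castSucc ∧ v i.succ < u i

/-- Level `k+1` (for `k < N`) of the configuration consisting of the triangular array `x`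
(levels `1, …, N-1`) together with the top level `a` (level `N`). -/
def lvl {N : ℕ} (a : Fin N → ℝ) (x : Tri (N - 1)) (k : ℕ) (hk : k < N) :
    Fin (k + 1) → ℝ :=
  if h : k < N - 1 then fun i => x ⟨k, h⟩ i
  else fun i => a ⟨i.1, by have := i.isLt; omega⟩

/-- The (unnormalized) density of the orbital beta process with top level `a`. -/
def obpWt (θ : ℝ) {N : ℕ} (a : Fin N → ℝ) (x : Tri (N - 1)) : ℝ :=
  ∏ k : Fin (N - 1),
    ((∏ i : Fin (k.1 + 1), ∏ j : Fin (k.1 + 1),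
        if i < j then |x k i - x k j| ^ (2 - 2 * θ) else 1) *
      ∏ s : Fin (k.1 + 2), ∏ r : Fin (k.1 + 1),
        |lvl a x (k.1 + 1) (by have := k.isLt; omega) s - x k r| ^ (θ - 1))

/-- The interlacing scheme `𝒫(a)`: arrays `(a⁽¹⁾ ≺ a⁽²⁾ ≺ ⋯ ≺ a⁽ᴺ⁻¹⁾ ≺ a)`. -/
def obpDomain {N : ℕ} (a : Fin N → ℝ) : Set (Tri (N - 1)) :=
  {x | ∀ k : Fin (N - 1),
      Interlaces (x k) (lvl a x (k.1 + 1) (by have := k.isLt; omega))}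

/-- The orbital beta process `𝕄^{a,θ}` with top level `a`. -/
def obp (θ : ℝ) {N : ℕ} (a : Fin N → ℝ) : Measure (Tri (N - 1)) :=
  (ENNReal.ofReal (∫ x in obpDomain a, obpWt θ a x))⁻¹ •
    volume.withDensity fun x =>
      ENNReal.ofReal ((obpDomain a).indicator (obpWt θ a) x)

/-- The Weyl chamber `𝒲_m = {x : x 0 ≥ x 1 ≥ ⋯}`. -/
def weylChamber (m : ℕ) : Set (Fin m → ℝ) :=
  {x | ∀ i j : Fin m, i ≤ j → x j ≤ x i}

/-- The (unnormalized) density of the Gaussian beta ensemble. -/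
def gbeWt (θ : ℝ) (m : ℕ) (x : Fin m → ℝ) : ℝ :=
  (∏ i : Fin m, ∏ j : Fin m, if i < j then |x i - x j| ^ (2 * θ) else 1) *
    Real.exp (-(θ / 2) * ∑ i, x i ^ 2)

/-- The Gaussian beta ensemble `𝕄^{(θ)}_m` of rank `m`. -/
def gbe (θ : ℝ) (m : ℕ) : Measure (Fin m → ℝ) :=
  (ENNReal.ofReal (∫ x in weylChamber m, gbeWt θ m x))⁻¹ •
    volume.withDensity fun x =>
      ENNReal.ofReal ((weylChamber m).indicator (gbeWt θ m) x)

/-- The empirical measure `μ_N = (1/N) ∑ δ_{a_i/N}`. -/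
def empMeasure {N : ℕ} (a : Fin N → ℝ) : Measure ℝ :=
  ((N : ℝ≥0∞))⁻¹ • ∑ i : Fin N, Measure.dirac (a i / N)

/-- The mean `𝔼[ν]` of a measure on `ℝ`. -/
def meanM (ν : Measure ℝ) : ℝ := ∫ t, t ∂ν

/-- The variance `Var[ν]` of a measure on `ℝ`. -/
def varM (ν : Measure ℝ) : ℝ := (∫ t, t ^ 2 ∂ν) - meanM ν ^ 2

/-- A regular sequence of ordered tuples with limiting measure `μ`. -/
def RegularSeq (a : (N : ℕ) → Fin N → ℝ) (μ : Measure ℝ) : Prop :=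
  (∀ N : ℕ, 1 ≤ N → StrictAnti (a N)) ∧
  (∃ C : ℝ, ∀ N : ℕ, ∀ hN : 1 ≤ N,
      |a N ⟨0, by omega⟩| ≤ C * N ∧ |a N ⟨N - 1, by omega⟩| ≤ C * N) ∧
  IsProbabilityMeasure μ ∧
  (∃ R : ℝ, μ {t : ℝ | |t| ≤ R}ᶜ = 0) ∧
  ∀ f : BoundedContinuousFunction ℝ ℝ,
    Tendsto (fun N : ℕ => ∫ t, f t ∂empMeasure (a N)) atTop (𝓝 (∫ t, f t ∂μ))

/-- Projection of a triangular array (with top level of size `N`) to its `m`-th level. -/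
def levelProj {N : ℕ} (m : ℕ) (h1 : 1 ≤ m) (h2 : m < N) (x : Tri (N - 1)) :
    Fin m → ℝ :=
  fun i => x ⟨m - 1, by omega⟩ ⟨i.1, (by have := i.isLt; omega : i.1 < m - 1 + 1)⟩

/-- Projection of a triangular array to its bottom `m` levels. -/
def triProj {N : ℕ} (m : ℕ) (h : m < N) (x : Tri (N - 1)) : Tri m :=
  fun k i => x ⟨k.1, by have := k.isLt; omega⟩ ⟨i.1, i.isLt⟩

/-- The top level of a triangular array with `m` levels. -/
def topLvl {m : ℕ} (hm : 1 ≤ m) (x : Tri m) : Fin m → ℝ :=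
  fun i => x ⟨m - 1, by omega⟩ ⟨i.1, (by have := i.isLt; omega : i.1 < m - 1 + 1)⟩

/-- The Gelfand–Tsetlin polytope `𝒲_{m,corners}` (weak interlacing). -/
def gtPoly (m : ℕ) : Set (Tri m) :=
  {x | ∀ k : Fin m, ∀ hk : k.1 + 1 < m, ∀ i : Fin (k.1 + 1),
      x k i ≤ x ⟨k.1 + 1, hk⟩ i.castSucc ∧ x ⟨k.1 + 1, hk⟩ i.succ ≤ x k i}

/-- Unnormalized density of the Gaussian beta corners process with `m` levels. -/
def gbcWt (θ : ℝ) {m : ℕ} (hm : 1 ≤ m) (x : Tri m) : ℝ :=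
  (∏ i : Fin m, ∏ j : Fin m,
      if i < j then topLvl hm x i - topLvl hm x j else 1) *
    Real.exp (-(θ / 2) * ∑ i, topLvl hm x i ^ 2) *
    ∏ k : Fin (m - 1),
      ((∏ i : Fin (k.1 + 1), ∏ j : Fin (k.1 + 1),
          if i < j then
            |x ⟨k.1, by have := k.isLt; omega⟩ i -
              x ⟨k.1, by have := k.isLt; omega⟩ j| ^ (2 - 2 * θ)
          else 1) *
        ∏ i : Fin (k.1 + 1), ∏ j : Fin (k.1 + 2),
          |x ⟨k.1, by have := k.isLt; omega⟩ i -
            x ⟨k.1 + 1, by have := k.isLt; omega⟩ j| ^ (θ - 1))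

/-- The Gaussian beta corners process `𝕄^{(θ)}_{m,corners}`. -/
def gbc (θ : ℝ) {m : ℕ} (hm : 1 ≤ m) : Measure (Tri m) :=
  (ENNReal.ofReal (∫ x in gtPoly m, gbcWt θ hm x))⁻¹ •
    volume.withDensity fun x =>
      ENNReal.ofReal ((gtPoly m).indicator (gbcWt θ hm) x)

/-- Strict interlacing domain `x⁽¹⁾ ≺ x⁽²⁾ ≺ ⋯ ≺ x⁽ᵐ⁾` inside `Tri m`. -/
def triDomain (m : ℕ) : Set (Tri m) :=
  {x | ∀ k : Fin m, ∀ hk : k.1 + 1 < m, Interlaces (x k) (x ⟨k.1 + 1, hk⟩)}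

/-- The θ-Gibbs conditional density of the bottom `n` levels given level `n+1`. -/
def gibbsWt (θ : ℝ) (n : ℕ) (x : Tri (n + 1)) : ℝ :=
  ((∏ k : Fin (n + 1), Real.Gamma ((k.1 + 1) * θ)) /
      Real.Gamma θ ^ ((n + 1) * (n + 2) / 2)) *
    (∏ i : Fin (n + 1), ∏ j : Fin (n + 1),
      if i < j then
        (x ⟨n, Nat.lt_succ_self n⟩ i - x ⟨n, Nat.lt_succ_self n⟩ j) ^ (1 - 2 * θ)
      else 1) *
    ∏ k : Fin n,
      ((∏ i : Fin (k.1 + 1), ∏ j : Fin (k.1 + 1),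
          if i < j then
            (x ⟨k.1, by have := k.isLt; omega⟩ i -
              x ⟨k.1, by have := k.isLt; omega⟩ j) ^ (2 - 2 * θ)
          else 1) *
        ∏ i : Fin (k.1 + 1), ∏ j : Fin (k.1 + 2),
          |x ⟨k.1, by have := k.isLt; omega⟩ i -
            x ⟨k.1 + 1, by have := k.isLt; omega⟩ j| ^ (θ - 1))

/-- `|a⁽ᵏ⁾|`, the sum of the entries of level `k` (with `a⁽⁰⁾ := 0` and `a⁽ᴺ⁾ := a`). -/
def sumLvl {N : ℕ} (a : Fin N → ℝ) (x : Tri (N - 1)) (k : ℕ) : ℝ :=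
  if k = 0 then 0
  else if h : k - 1 < N - 1 then ∑ i, x ⟨k - 1, h⟩ i
  else ∑ i, a i

/-- The multivariate Bessel function `𝓑_a(y; θ)`, defined through its combinatorial
integral representation over the interlacing scheme with top level `a`. -/
def MBF (θ : ℝ) {N : ℕ} (a : Fin N → ℝ) (y : Fin N → ℂ) : ℂ :=
  ((((∏ k : Fin N, Real.Gamma ((k.1 + 1) * θ)) /
        Real.Gamma θ ^ (N * (N + 1) / 2)) : ℝ) : ℂ) *
    (((∏ i : Fin N, ∏ j : Fin N,
        if i < j then |a i - a j| ^ (1 - 2 * θ) else 1) : ℝ) : ℂ) *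
    ∫ x in obpDomain a,
      Complex.exp (∑ k : Fin N,
        y k * ((sumLvl a x (k.1 + 1) - sumLvl a x k.1 : ℝ) : ℂ)) *
      ((obpWt θ a x : ℝ) : ℂ)

/-- Padding of an `m`-tuple with `N - m` zeros: `(y_1, …, y_m, 0^{N-m})`. -/
def padC {m N : ℕ} (_h : m ≤ N) (y : Fin m → ℂ) : Fin N → ℂ :=
  fun k => if h' : k.1 < m then y ⟨k.1, h'⟩ else 0

/-- Integrand `exp(yz) ∏ (z - a_i)^{-θ}` of the left-directed contour integral,
with `w^{-θ} := exp(-θ Log w)` for the principal branch `Log`. -/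
def contourFnL (θ : ℝ) {N : ℕ} (a : Fin N → ℝ) (y z : ℂ) : ℂ :=
  Complex.exp (y * z) *
    ∏ i : Fin N, Complex.exp (-(θ : ℂ) * Complex.log (z - (a i : ℂ)))

/-- Integrand `exp(-yz) ∏ (a_i - z)^{-θ}` of the right-directed contour integral. -/
def contourFnR (θ : ℝ) {N : ℕ} (a : Fin N → ℝ) (y z : ℂ) : ℂ :=
  Complex.exp (-y * z) *
    ∏ i : Fin N, Complex.exp (-(θ : ℂ) * Complex.log ((a i : ℂ) - z))

/-- `(y_1, …, y_m, y_{m+1})` with `y_{m+1} := y - (z_1 + ⋯ + z_m)`. -/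
def Yext {m : ℕ} (ys : Fin m → ℝ) (y : ℝ) (z : Fin m → ℝ) : Fin (m + 1) → ℝ :=
  fun j => if h : j.1 < m then ys ⟨j.1, h⟩ else y - ∑ i, z i

/-- `(z_1, …, z_m, z_{m+1})` with `z_{m+1} := 0`. -/
def Zext {m : ℕ} (z : Fin m → ℝ) : Fin (m + 1) → ℝ :=
  fun j => if h : j.1 < m then z ⟨j.1, h⟩ else 0

/-- The function `G_{θ, y_1, …, y_m, y}(z_1, …, z_m)`. -/
def Gfn (θ : ℝ) {m : ℕ} (ys : Fin m → ℝ) (y : ℝ) (z : Fin m → ℝ) : ℝ :=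
  (∏ i : Fin m, ∏ j : Fin m,
      if i < j then (ys i - ys j + z i) ^ (θ - 1) else 1) *
    ∏ i : Fin (m + 1), ∏ j : Fin (m + 1),
      if i < j then
        (Yext ys y z i - Yext ys y z j + Zext z i - Zext z j) *
          (Yext ys y z i - Yext ys y z j - Zext z j) ^ (θ - 1)
      else 1

/-- The function `F_{y_1, …, y_m, y}(z_1, …, z_m)`. -/
def Ffn {m : ℕ} (ys : Fin m → ℝ) (y : ℝ) (z : Fin m → ℝ) : ℝ :=
  (1 - (∑ i, z i) / y) * ∏ i, (1 + z i / ys i)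

/-- The absolute value of the Vandermonde product of a tuple. -/
def vdm {n : ℕ} (a : Fin n → ℝ) : ℝ :=
  ∏ i : Fin n, ∏ j : Fin n, if i < j then |a i - a j| else 1

lemma vdm_pos {n : ℕ} {a : Fin n → ℝ} (ha : Function.Injective a) : 0 < vdm a := by
  refine Finset.prod_pos fun i _ => Finset.prod_pos fun j _ => ?_
  split_ifs with h
  · exact abs_pos.2 (sub_ne_zero.2 fun e => h.ne (ha e))
  · exact one_pos

lemma vdm_rpow {n : ℕ} (a : Fin n → ℝ) (p : ℝ) :
    (∏ i : Fin n, ∏ j : Fin n, if i < j then |a i - a j| ^ p else 1) = vdm a ^ p := by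
  have h0 : ∀ i j : Fin n, 0 ≤ (if i < j then |a i - a j| else 1) := fun i j => by
    split_ifs <;> positivity
  rw [vdm, ← Real.finsetProd_rpow _ _ fun i _ => Finset.prod_nonneg fun j _ => h0 i j]
  refine Finset.prod_congr rfl fun i _ => ?_
  rw [← Real.finsetProd_rpow _ _ fun j _ => h0 i j]
  refine Finset.prod_congr rfl fun j _ => ?_
  split_ifs <;> simp

lemma abs_det_vandermonde {n : ℕ} (a : Fin n → ℝ) :
    |(Matrix.vandermonde a).det| = vdm a := by
  rw [Matrix.det_vandermonde, Finset.abs_prod, vdm]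
  refine Finset.prod_congr rfl fun i _ => ?_
  rw [Finset.abs_prod, ← Finset.prod_filter]
  refine Finset.prod_congr (by ext; simp) fun j _ => abs_sub_comm _ _

lemma prod_erase_abs_sub {n : ℕ} (a : Fin n → ℝ) :
    ∏ i : Fin n, ∏ j ∈ Finset.univ.erase i, |a i - a j| = vdm a ^ 2 := by
  have h : ∀ i : Fin n, ∏ j ∈ Finset.univ.erase i, |a i - a j| =
      ∏ j : Fin n, ((if i < j then |a i - a j| else 1) * if j < i then |a j - a i| else 1) := by
    intro i
    rw [← Finset.mul_prod_erase Finset.univ _ (Finset.mem_univ i)]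
    simp only [lt_irrefl, if_false, mul_one, one_mul]
    refine Finset.prod_congr rfl fun j hj => ?_
    rcases lt_or_gt_of_ne (Finset.ne_of_mem_erase hj) with h | h
    · simp [h, h.not_gt, abs_sub_comm]
    · simp [h, h.not_gt]
  simp_rw [h, Finset.prod_mul_distrib]
  rw [sq, vdm]
  congr 1
  rw [Finset.prod_comm]

/-- The absolute value of the Cauchy determinant. -/
lemma abs_det_cauchy {n : ℕ} {a b : Fin n → ℝ} (ha : Function.Injective a)
    (hab : ∀ i j, b i ≠ a j) :
    |(Matrix.of fun i j => (b i - a j)⁻¹).det| =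
      vdm a * vdm b / ∏ i, ∏ j, |b i - a j| := by
  classical
  let p : Fin n → Polynomial ℝ := fun j => ∏ k ∈ Finset.univ.erase j, (Polynomial.X - Polynomial.C (a k))
  let K : Matrix (Fin n) (Fin n) ℝ := Matrix.of fun m j => (p j).coeff m
  have hdeg : ∀ j, (p j).natDegree < n := fun j => by
    have : (p j).natDegree = (Finset.univ.erase j).card := by
      simp only [p]
      exact Polynomial.natDegree_finsetProd_X_sub_C_eq_card _ _
    rw [this, Finset.card_erase_of_mem (Finset.mem_univ j), Finset.card_univ, Fintype.card_fin]
    have := j.isLt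
    omega
  have hmul : ∀ c : Fin n → ℝ, Matrix.vandermonde c * K =
      Matrix.of fun i j => ∏ k ∈ Finset.univ.erase j, (c i - a k) := by
    intro c
    ext i j
    have : (p j).eval (c i) = ∏ k ∈ Finset.univ.erase j, (c i - a k) := by
      simp [p, Polynomial.eval_prod]
    rw [Matrix.of_apply, ← this, Polynomial.eval_eq_sum_range' (hdeg j), Matrix.mul_apply,
      Finset.sum_range]
    exact Finset.sum_congr rfl fun m _ => by simp [K, Matrix.vandermonde_apply, mul_comm]
  have hK : |K.det| = vdm a := by
    have h1 := congrArg (fun A => |Matrix.det A|) (hmul a)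
    have h2 : (Matrix.of fun i j => ∏ k ∈ Finset.univ.erase j, (a i - a k)) =
        Matrix.diagonal fun i => ∏ k ∈ Finset.univ.erase i, (a i - a k) := by
      ext i j
      rcases eq_or_ne i j with rfl | h
      · simp
      · rw [Matrix.diagonal_apply_ne _ h, Matrix.of_apply]
        exact Finset.prod_eq_zero (Finset.mem_erase.2 ⟨h, Finset.mem_univ i⟩) (sub_self _)
    simp only [h2, Matrix.det_mul, Matrix.det_diagonal, abs_mul, abs_det_vandermonde,
      Finset.abs_prod, prod_erase_abs_sub, sq] at h1
    exact mul_left_cancel₀ (vdm_pos ha).ne' h1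
  have h3 : (Matrix.of fun i j => ∏ k ∈ Finset.univ.erase j, (b i - a k)) =
      Matrix.diagonal (fun i => ∏ k, (b i - a k)) * Matrix.of fun i j => (b i - a j)⁻¹ := by
    ext i j
    rw [Matrix.diagonal_mul, Matrix.of_apply, Matrix.of_apply,
      ← Finset.mul_prod_erase Finset.univ _ (Finset.mem_univ j)]
    field_simp [sub_ne_zero.2 (hab i j)]
  have h4 := congrArg (fun A => |Matrix.det A|) (hmul b)
  simp only [h3, Matrix.det_mul, Matrix.det_diagonal, abs_mul, abs_det_vandermonde,
    Finset.abs_prod, hK] at h4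
  have h5 : (∏ i, ∏ j, |b i - a j|) ≠ 0 :=
    Finset.prod_ne_zero_iff.2 fun i _ => Finset.prod_ne_zero_iff.2 fun j _ =>
      abs_ne_zero.2 (sub_ne_zero.2 (hab i j))
  rw [eq_div_iff h5, mul_comm (vdm a), h4, mul_comm]

lemma Interlaces.sub_div_sub_pos {n : ℕ} {a : Fin n → ℝ} {b : Fin (n + 1) → ℝ} (hb : StrictAnti b)
    (h : Interlaces a b) (j : Fin (n + 1)) (i : Fin n) :
    0 < (b j - a i) / (b j - b (j.succAbove i)) := by
  rcases lt_or_ge i.castSucc j with hij | hij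
  · rw [Fin.succAbove_of_castSucc_lt _ _ hij]
    have h1 : b j ≤ b i.succ := hb.antitone (Fin.castSucc_lt_iff_succ_le.1 hij)
    exact div_pos_of_neg_of_neg (by linarith [(h i).2]) (by linarith [hb hij])
  · rw [Fin.succAbove_of_le_castSucc _ _ hij]
    have h1 : b i.castSucc ≤ b j := hb.antitone hij
    exact div_pos (by linarith [(h i).1]) (by linarith [(h i).1, (h i).2])

lemma Interlaces.sub_ne_zero {n : ℕ} {a : Fin n → ℝ} {b : Fin (n + 1) → ℝ} (hb : StrictAnti b)
    (h : Interlaces a b) (j : Fin (n + 1)) (i : Fin n) : b j - a i ≠ 0 := by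
  intro h0
  have := h.sub_div_sub_pos hb j i
  simp [h0] at this

lemma Interlaces.strictAnti {n : ℕ} {a : Fin n → ℝ} {b : Fin (n + 1) → ℝ} (hb : StrictAnti b)
    (h : Interlaces a b) : StrictAnti a := by
  intro i j hij
  have h1 : b j.castSucc ≤ b i.succ := hb.antitone (by
    rw [Fin.le_def]; simpa using hij)
  linarith [(h i).2, (h j).1]

/-- The residues of `∏ (z - aᵢ) / ∏ (z - bⱼ)` at the points `bⱼ`. -/
def residueWt {n : ℕ} (b : Fin (n + 1) → ℝ) (a : Fin n → ℝ) (j : Fin (n + 1)) : ℝ :=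
  ∏ i, (b j - a i) / (b j - b (j.succAbove i))

/-- The residues, normalized so that the last one is `1`. -/
def residueRatio {n : ℕ} (b : Fin (n + 1) → ℝ) (a : Fin n → ℝ) (j : Fin n) : ℝ :=
  residueWt b a j.castSucc / residueWt b a (Fin.last n)

lemma residueWt_pos {n : ℕ} {a : Fin n → ℝ} {b : Fin (n + 1) → ℝ} (hb : StrictAnti b)
    (h : Interlaces a b) (j : Fin (n + 1)) : 0 < residueWt b a j :=
  Finset.prod_pos fun i _ => h.sub_div_sub_pos hb j i

lemma sub_succAbove_ne_zero {n : ℕ} {b : Fin (n + 1) → ℝ} (hb : Function.Injective b)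
    (j : Fin (n + 1)) (i : Fin n) : b j - b (j.succAbove i) ≠ 0 :=
  sub_ne_zero.2 fun e => Fin.succAbove_ne j i (hb e).symm

/-- The numerator of `∑ wⱼ / (z - bⱼ)`. -/
def pfNum {n : ℕ} (b w : Fin (n + 1) → ℝ) : Polynomial ℝ :=
  ∑ j, Polynomial.C (w j) * ∏ i : Fin n, (Polynomial.X - Polynomial.C (b (j.succAbove i)))

lemma pfNum_eval {n : ℕ} (b w : Fin (n + 1) → ℝ) (z : ℝ) :
    (pfNum b w).eval z = ∑ j, w j * ∏ i, (z - b (j.succAbove i)) := by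
  simp [pfNum, Polynomial.eval_finsetSum, Polynomial.eval_prod]

lemma pfNum_eval_node {n : ℕ} (b w : Fin (n + 1) → ℝ) (j : Fin (n + 1)) :
    (pfNum b w).eval (b j) = w j * ∏ i, (b j - b (j.succAbove i)) := by
  rw [pfNum_eval, Finset.sum_eq_single j _ (by simp)]
  intro k _ hk
  obtain ⟨i, hi⟩ := Fin.exists_succAbove_eq hk.symm
  rw [Finset.prod_eq_zero (Finset.mem_univ i) (by rw [hi, sub_self]), mul_zero]

lemma natDegree_prod_X_sub {n : ℕ} (a : Fin n → ℝ) :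
    (∏ i, (Polynomial.X - Polynomial.C (a i))).natDegree = n := by
  rw [Polynomial.natDegree_finsetProd_X_sub_C_eq_card, Finset.card_univ, Fintype.card_fin]

lemma coeff_prod_X_sub {n : ℕ} (a : Fin n → ℝ) :
    (∏ i, (Polynomial.X - Polynomial.C (a i))).coeff n = 1 := by
  have h := Polynomial.monic_prod_X_sub_C a Finset.univ
  rw [Polynomial.Monic, Polynomial.leadingCoeff, natDegree_prod_X_sub] at h
  exact h

lemma pfNum_natDegree_le {n : ℕ} (b w : Fin (n + 1) → ℝ) : (pfNum b w).natDegree ≤ n :=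
  Polynomial.natDegree_sum_le_of_forall_le _ _ fun _ _ =>
    (Polynomial.natDegree_C_mul_le _ _).trans (natDegree_prod_X_sub _).le

lemma pfNum_coeff {n : ℕ} (b w : Fin (n + 1) → ℝ) : (pfNum b w).coeff n = ∑ j, w j := by
  rw [pfNum, Polynomial.finsetSum_coeff]
  exact Finset.sum_congr rfl fun j _ => by
    rw [Polynomial.coeff_C_mul, coeff_prod_X_sub, mul_one]

lemma prod_X_sub_eq_pfNum {n : ℕ} {b : Fin (n + 1) → ℝ} (hb : Function.Injective b)
    (a : Fin n → ℝ) :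
    ∏ i, (Polynomial.X - Polynomial.C (a i)) = pfNum b (residueWt b a) := by
  have hcard : ((Finset.univ : Finset (Fin (n + 1))).card : WithBot ℕ) = ((n + 1 : ℕ) : WithBot ℕ) := by
    simp
  refine Polynomial.eq_of_degrees_lt_of_eval_index_eq (v := b) Finset.univ hb.injOn ?_ ?_ ?_
  · rw [hcard]
    exact Polynomial.degree_lt_iff_coeff_zero _ _ |>.2 fun m hm =>
      Polynomial.coeff_eq_zero_of_natDegree_lt (by rw [natDegree_prod_X_sub]; omega)
  · rw [hcard]
    exact Polynomial.degree_lt_iff_coeff_zero _ _ |>.2 fun m hm =>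
      Polynomial.coeff_eq_zero_of_natDegree_lt ((pfNum_natDegree_le b _).trans_lt (by omega))
  · intro j _
    rw [pfNum_eval_node, residueWt, ← Finset.prod_mul_distrib, Polynomial.eval_prod]
    refine Finset.prod_congr rfl fun i _ => ?_
    have := sub_succAbove_ne_zero hb j i
    simp only [Polynomial.eval_sub, Polynomial.eval_X, Polynomial.eval_C]
    field_simp

lemma sum_residueWt {n : ℕ} {b : Fin (n + 1) → ℝ} (hb : Function.Injective b) (a : Fin n → ℝ) :
    ∑ j, residueWt b a j = 1 := by
  rw [← pfNum_coeff b, ← prod_X_sub_eq_pfNum hb, coeff_prod_X_sub]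

lemma prod_sub_eq_sum {n : ℕ} {b : Fin (n + 1) → ℝ} (hb : Function.Injective b) (a : Fin n → ℝ)
    {z : ℝ} (hz : ∀ j, z - b j ≠ 0) :
    ∏ i, (z - a i) = (∏ j, (z - b j)) * ∑ j, residueWt b a j / (z - b j) := by
  have h := congrArg (Polynomial.eval z) (prod_X_sub_eq_pfNum hb a)
  rw [pfNum_eval] at h
  simp only [Polynomial.eval_prod, Polynomial.eval_sub, Polynomial.eval_X, Polynomial.eval_C] at h
  rw [h, Finset.mul_sum]
  refine Finset.sum_congr rfl fun j _ => ?_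
  rw [Fin.prod_univ_succAbove _ j]
  field_simp [hz j]

lemma residueRatio_pos {n : ℕ} {a : Fin n → ℝ} {b : Fin (n + 1) → ℝ} (hb : StrictAnti b)
    (h : Interlaces a b) (j : Fin n) : 0 < residueRatio b a j :=
  div_pos (residueWt_pos hb h _) (residueWt_pos hb h _)

lemma one_add_sum_residueRatio {n : ℕ} {a : Fin n → ℝ} {b : Fin (n + 1) → ℝ} (hb : StrictAnti b)
    (h : Interlaces a b) :
    1 + ∑ j, residueRatio b a j = (residueWt b a (Fin.last n))⁻¹ := by
  have h0 := residueWt_pos hb h (Fin.last n)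
  have h1 := sum_residueWt hb.injective a
  rw [Fin.sum_univ_castSucc] at h1
  simp only [residueRatio]
  rw [← Finset.sum_div, eq_sub_of_add_eq h1]
  field_simp
  ring

lemma residueWt_inj {n : ℕ} {a a' : Fin n → ℝ} {b : Fin (n + 1) → ℝ} (hb : StrictAnti b)
    (h : Interlaces a b) (h' : Interlaces a' b) (e : residueWt b a = residueWt b a') : a = a' := by
  have h1 := (prod_X_sub_eq_pfNum hb.injective a).trans
    ((congrArg (pfNum b) e).trans (prod_X_sub_eq_pfNum hb.injective a').symm)
  funext i
  have h2 := congrArg (Polynomial.eval (a i)) h1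
  simp only [Polynomial.eval_prod, Polynomial.eval_sub, Polynomial.eval_X, Polynomial.eval_C] at h2
  rw [Finset.prod_eq_zero (Finset.mem_univ i) (sub_self _), eq_comm, Finset.prod_eq_zero_iff] at h2
  obtain ⟨k, -, hk⟩ := h2
  have hk' : a i = a' k := sub_eq_zero.1 hk
  rcases lt_trichotomy i k with hik | hik | hik
  · have h3 : b k.castSucc ≤ b i.succ := hb.antitone (by rw [Fin.le_def]; simpa using hik)
    linarith [(h i).2, (h' k).1]
  · rw [hk', hik]
  · have h3 : b i.castSucc ≤ b k.succ := hb.antitone (by rw [Fin.le_def]; simpa using hik)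
    linarith [(h i).1, (h' k).2]

lemma residueRatio_injOn {n : ℕ} {b : Fin (n + 1) → ℝ} (hb : StrictAnti b) :
    Set.InjOn (residueRatio b) {a | Interlaces a b} := by
  intro a h a' h' e
  refine residueWt_inj hb h h' ?_
  have h1 : residueWt b a (Fin.last n) = residueWt b a' (Fin.last n) := by
    rw [← inv_inj, ← one_add_sum_residueRatio hb h, ← one_add_sum_residueRatio hb h', e]
  funext j
  refine Fin.lastCases h1 (fun j => ?_) j
  have h2 := congrFun e j
  rw [residueRatio, residueRatio, h1] at h2
  exact (div_left_inj' (residueWt_pos hb h' _).ne').1 h2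

lemma prod_node_mul_neg {n : ℕ} {b : Fin (n + 1) → ℝ} (hb : StrictAnti b) (i : Fin n) :
    (∏ m, (b i.castSucc - b (i.castSucc.succAbove m))) *
      ∏ m, (b i.succ - b (i.succ.succAbove m)) < 0 := by
  rw [← Finset.prod_mul_distrib, ← Finset.mul_prod_erase Finset.univ _ (Finset.mem_univ i)]
  have hi : b i.succ < b i.castSucc := hb (Fin.castSucc_lt_succ)
  refine mul_neg_of_neg_of_pos ?_ (Finset.prod_pos fun m hm => ?_)
  · rw [Fin.succAbove_castSucc_self, Fin.succAbove_succ_self]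
    exact mul_neg_of_pos_of_neg (by linarith) (by linarith)
  · rcases lt_or_gt_of_ne (Finset.ne_of_mem_erase hm) with h | h
    · rw [Fin.succAbove_of_castSucc_lt _ _ (Fin.castSucc_lt_castSucc_iff.2 h),
        Fin.succAbove_of_castSucc_lt _ _ ((Fin.castSucc_lt_castSucc_iff.2 h).trans Fin.castSucc_lt_succ)]
      have h1 : b i.castSucc < b m.castSucc := hb (Fin.castSucc_lt_castSucc_iff.2 h)
      exact mul_pos_of_neg_of_neg (by linarith) (by linarith)
    · have h2 : i.succ ≤ m.castSucc := by rw [Fin.le_def]; simpa using h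
      rw [Fin.succAbove_of_le_castSucc _ _ h2,
        Fin.succAbove_of_le_castSucc _ _ (Fin.castSucc_lt_succ.le.trans h2)]
      have h1 : b m.succ < b i.succ := hb (Fin.succ_lt_succ_iff.2 h)
      exact mul_pos (by linarith) (by linarith)

lemma exists_interlaces_residueWt {n : ℕ} {b w : Fin (n + 1) → ℝ} (hb : StrictAnti b)
    (hw : ∀ j, 0 < w j) (hs : ∑ j, w j = 1) :
    ∃ a, Interlaces a b ∧ residueWt b a = w := by
  have hroot : ∀ i : Fin n, ∃ x, (x < b i.castSucc ∧ b i.succ < x) ∧ (pfNum b w).eval x = 0 := by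
    intro i
    have hneg : (pfNum b w).eval (b i.castSucc) * (pfNum b w).eval (b i.succ) < 0 := by
      rw [pfNum_eval_node, pfNum_eval_node, mul_mul_mul_comm]
      exact mul_neg_of_pos_of_neg (mul_pos (hw _) (hw _)) (prod_node_mul_neg hb i)
    have hi : b i.succ < b i.castSucc := hb (Fin.castSucc_lt_succ)
    have hc : ContinuousOn (fun x => (pfNum b w).eval x) (Set.Icc (b i.succ) (b i.castSucc)) :=
      (pfNum b w).continuous.continuousOn
    rcases mul_neg_iff.1 hneg with ⟨h1, h2⟩ | ⟨h1, h2⟩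
    · obtain ⟨x, hx, hx0⟩ := intermediate_value_Ioo hi.le hc ⟨h2, h1⟩
      exact ⟨x, ⟨hx.2, hx.1⟩, hx0⟩
    · obtain ⟨x, hx, hx0⟩ := intermediate_value_Ioo' hi.le hc ⟨h1, h2⟩
      exact ⟨x, ⟨hx.2, hx.1⟩, hx0⟩
  choose a ha ha0 using hroot
  have hint : Interlaces a b := ha
  refine ⟨a, hint, ?_⟩
  have hpoly : ∏ i, (Polynomial.X - Polynomial.C (a i)) = pfNum b w := by
    refine Polynomial.eq_of_degree_sub_lt_of_eval_finset_eq (Finset.univ.image a) ?_ ?_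
    · rw [Finset.card_image_of_injective _ (hint.strictAnti hb).injective, Finset.card_univ,
        Fintype.card_fin, Polynomial.degree_lt_iff_coeff_zero]
      intro m hm
      rw [Polynomial.coeff_sub]
      rcases hm.eq_or_lt with rfl | hm
      · rw [coeff_prod_X_sub, pfNum_coeff, hs, sub_self]
      · rw [Polynomial.coeff_eq_zero_of_natDegree_lt (by rw [natDegree_prod_X_sub]; omega),
          Polynomial.coeff_eq_zero_of_natDegree_lt ((pfNum_natDegree_le b w).trans_lt hm), sub_self]
    · intro x hx
      obtain ⟨i, -, rfl⟩ := Finset.mem_image.1 hx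
      rw [ha0, Polynomial.eval_prod]
      exact Finset.prod_eq_zero (Finset.mem_univ i) (by simp)
  funext j
  have h1 := congrArg (Polynomial.eval (b j)) ((prod_X_sub_eq_pfNum hb.injective a).symm.trans hpoly)
  rw [pfNum_eval_node, pfNum_eval_node] at h1
  exact mul_right_cancel₀
    (Finset.prod_ne_zero_iff.2 fun i _ => sub_succAbove_ne_zero hb.injective j i) h1

lemma residueRatio_image {n : ℕ} {b : Fin (n + 1) → ℝ} (hb : StrictAnti b) :
    residueRatio b '' {a | Interlaces a b} = {v | ∀ j, 0 < v j} := by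
  refine Set.Subset.antisymm ?_ fun v hv => ?_
  · rintro _ ⟨a, h, rfl⟩ j
    exact residueRatio_pos hb h j
  · have hv' : ∀ j, 0 < v j := hv
    have hS : 0 < 1 + ∑ j, v j := by
      have := Finset.sum_nonneg fun j (_ : j ∈ Finset.univ) => (hv' j).le
      linarith
    obtain ⟨a, h, hw⟩ := exists_interlaces_residueWt (n := n)
      (w := fun j => (Fin.snoc v 1 : Fin (n + 1) → ℝ) j / (1 + ∑ j, v j)) hb
      (fun j => Fin.lastCases (by simpa using hS) (fun j => by simpa using div_pos (hv' j) hS) j)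
      (by rw [← Finset.sum_div, Fin.sum_univ_castSucc]
          simp only [Fin.snoc_castSucc, Fin.snoc_last]
          rw [add_comm, div_self hS.ne'])
    refine ⟨a, h, ?_⟩
    funext j
    rw [residueRatio, hw]
    simp only [Fin.snoc_castSucc, Fin.snoc_last]
    field_simp

lemma vdm_castSucc {n : ℕ} (b : Fin (n + 1) → ℝ) :
    vdm b = vdm (fun j : Fin n => b j.castSucc) * ∏ j : Fin n, |b j.castSucc - b (Fin.last n)| := by
  rw [vdm, Fin.prod_univ_castSucc]
  have h : (∏ j : Fin (n + 1), if Fin.last n < j then |b (Fin.last n) - b j| else 1) = 1 :=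
    Finset.prod_eq_one fun j _ => by simp [(Fin.le_last j).not_gt]
  rw [h, mul_one, vdm, ← Finset.prod_mul_distrib]
  refine Finset.prod_congr rfl fun i _ => ?_
  rw [Fin.prod_univ_castSucc]
  simp [Fin.castSucc_lt_last]

lemma prod_abs_sub_succAbove {n : ℕ} (b : Fin (n + 1) → ℝ) :
    ∏ j, ∏ i, |b j - b (j.succAbove i)| = vdm b ^ 2 := by
  rw [← prod_erase_abs_sub]
  refine Finset.prod_congr rfl fun j _ => ?_
  rw [← Finset.compl_singleton, ← Fin.image_succAbove_univ,
    Finset.prod_image (Fin.succAbove_right_injective).injOn]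

lemma prod_residueWt {n : ℕ} {a : Fin n → ℝ} {b : Fin (n + 1) → ℝ} (hb : StrictAnti b)
    (h : Interlaces a b) :
    ∏ j, residueWt b a j = (∏ j, ∏ i, |b j - a i|) / vdm b ^ 2 := by
  rw [← prod_abs_sub_succAbove, ← Finset.prod_div_distrib]
  refine Finset.prod_congr rfl fun j _ => ?_
  rw [residueWt, ← Finset.prod_div_distrib]
  exact Finset.prod_congr rfl fun i _ => by
    rw [← abs_div, abs_of_pos (h.sub_div_sub_pos hb j i)]

/-- The Jacobian matrix of `residueRatio b` at `a`. -/
def residueJac {n : ℕ} (b : Fin (n + 1) → ℝ) (a : Fin n → ℝ) : Matrix (Fin n) (Fin n) ℝ :=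
  Matrix.diagonal (fun j => residueRatio b a j * (b j.castSucc - b (Fin.last n))) *
    (Matrix.of fun j i => (b j.castSucc - a i)⁻¹) *
    Matrix.diagonal fun i => (b (Fin.last n) - a i)⁻¹

lemma hasFDerivAt_residueRatio {n : ℕ} {a : Fin n → ℝ} {b : Fin (n + 1) → ℝ} (hb : StrictAnti b)
    (h : Interlaces a b) :
    HasFDerivAt (residueRatio b) (Matrix.toLin' (residueJac b a)).toContinuousLinearMap a := by
  have hpi : (Matrix.toLin' (residueJac b a)).toContinuousLinearMap =
      ContinuousLinearMap.pi fun j =>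
        (ContinuousLinearMap.proj j).comp (Matrix.toLin' (residueJac b a)).toContinuousLinearMap := by
    ext; rfl
  rw [hpi]
  refine hasFDerivAt_pi.2 fun j => ?_
  set κ : ℝ := ∏ i, (b (Fin.last n) - b ((Fin.last n).succAbove i)) /
    (b j.castSucc - b (j.castSucc.succAbove i)) with hκ
  have hfun : ∀ x : Fin n → ℝ, residueRatio b x j =
      κ * ∏ i, (b j.castSucc - x i) / (b (Fin.last n) - x i) := by
    intro x
    rw [residueRatio, residueWt, residueWt, ← Finset.prod_div_distrib, hκ, ← Finset.prod_mul_distrib]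
    exact Finset.prod_congr rfl fun i _ => by
      rw [div_div_div_eq, div_mul_div_comm, mul_comm (b j.castSucc - x i), mul_comm (b j.castSucc - b _)]
  have hg : ∀ i ∈ (Finset.univ : Finset (Fin n)), HasFDerivAt
      (fun x : Fin n → ℝ => (b j.castSucc - x i) / (b (Fin.last n) - x i))
      (((b j.castSucc - b (Fin.last n)) / (b (Fin.last n) - a i) ^ 2) •
        (ContinuousLinearMap.proj i : (Fin n → ℝ) →L[ℝ] ℝ)) a := by
    intro i _
    have h1 : HasDerivAt (fun t : ℝ => (b j.castSucc - t) / (b (Fin.last n) - t))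
        ((b j.castSucc - b (Fin.last n)) / (b (Fin.last n) - a i) ^ 2) (a i) := by
      have := ((hasDerivAt_id (a i)).const_sub (b j.castSucc)).div
        ((hasDerivAt_id (a i)).const_sub (b (Fin.last n))) (h.sub_ne_zero hb _ i)
      refine this.congr_deriv ?_
      simp only [id]
      ring
    exact h1.comp_hasFDerivAt a (ContinuousLinearMap.proj (R := ℝ) (φ := fun _ : Fin n => ℝ) i).hasFDerivAt
  have h2 := (HasFDerivAt.finsetProd hg).const_mul κ
  have h3 : (fun x => residueRatio b x j) =
      fun x => κ * ∏ i, (b j.castSucc - x i) / (b (Fin.last n) - x i) := funext hfun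
  rw [h3]
  refine h2.congr_fderiv ?_
  ext u
  simp only [smul_apply, sum_apply,
    ContinuousLinearMap.proj_apply, ContinuousLinearMap.comp_apply, smul_eq_mul,
    LinearMap.coe_toContinuousLinearMap', Matrix.toLin'_apply, Matrix.mulVec, dotProduct,
    Finset.mul_sum]
  refine Finset.sum_congr rfl fun i _ => ?_
  rw [residueJac, Matrix.mul_diagonal, Matrix.diagonal_mul, Matrix.of_apply, hfun,
    ← Finset.mul_prod_erase Finset.univ _ (Finset.mem_univ i)]
  have h4 := h.sub_ne_zero hb j.castSucc i
  have h5 := h.sub_ne_zero hb (Fin.last n) i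
  field_simp

lemma abs_det_residueJac {n : ℕ} {a : Fin n → ℝ} {b : Fin (n + 1) → ℝ} (hb : StrictAnti b)
    (h : Interlaces a b) :
    |(residueJac b a).det| =
      (∏ j, residueRatio b a j) * vdm b * vdm a / ∏ j, ∏ i, |b j - a i| := by
  rw [residueJac, Matrix.det_mul, Matrix.det_mul, Matrix.det_diagonal, Matrix.det_diagonal,
    abs_mul, abs_mul, abs_det_cauchy (h.strictAnti hb).injective
      (fun i j => sub_ne_zero.1 (h.sub_ne_zero hb _ _)), Finset.prod_mul_distrib, abs_mul,
    abs_of_pos (Finset.prod_pos fun j _ => residueRatio_pos hb h j), Finset.abs_prod,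
    Finset.prod_inv_distrib, abs_inv, Finset.abs_prod, vdm_castSucc b,
    Fin.prod_univ_castSucc (fun j => ∏ i, |b j - a i|), mul_comm (∏ j : Fin n, ∏ i, _)]
  simp only [div_eq_mul_inv, mul_inv]
  ring

/-- The density of the Dirichlet law (up to a constant) in projective coordinates. -/
def dirichletDens (θ : ℝ) {n : ℕ} (v : Fin n → ℝ) : ℝ :=
  (∏ j, v j ^ (θ - 1)) * (1 + ∑ j, v j) ^ (-((n + 1) * θ))

/-- The transition density (up to a constant) of the Dixon–Anderson kernel. -/
def daDens (θ : ℝ) {n : ℕ} (b : Fin (n + 1) → ℝ) (a : Fin n → ℝ) : ℝ :=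
  vdm b ^ (1 - 2 * θ) * vdm a * ∏ s, ∏ r, |b s - a r| ^ (θ - 1)

lemma abs_det_mul_dirichletDens (θ : ℝ) {n : ℕ} {a : Fin n → ℝ} {b : Fin (n + 1) → ℝ}
    (hb : StrictAnti b) (h : Interlaces a b) :
    |(residueJac b a).det| * dirichletDens θ (residueRatio b a) = daDens θ b a := by
  have hw := residueWt_pos hb h
  have hv := residueRatio_pos hb h
  have hA : 0 < ∏ j, ∏ i, |b j - a i| :=
    Finset.prod_pos fun j _ => Finset.prod_pos fun i _ => abs_pos.2 (h.sub_ne_zero hb j i)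
  have hV := vdm_pos hb.injective
  have h1 : (∏ j, residueRatio b a j) = (∏ j, residueWt b a j) /
      residueWt b a (Fin.last n) ^ (n + 1 : ℝ) := by
    simp only [residueRatio]
    rw [Finset.prod_div_distrib, Fin.prod_univ_castSucc (residueWt b a)]
    have := (hw (Fin.last n)).ne'
    rw [Finset.prod_const, Finset.card_univ, Fintype.card_fin, ← Nat.cast_add_one, Real.rpow_natCast]
    field_simp
    ring
  have h2 : (∏ j, residueRatio b a j) * dirichletDens θ (residueRatio b a) =
      (∏ j, residueWt b a j) ^ θ := by
    rw [dirichletDens, Real.finsetProd_rpow _ _ fun j _ => (hv j).le, ← mul_assoc,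
      one_add_sum_residueRatio hb h]
    have hp : 0 < ∏ j, residueRatio b a j := Finset.prod_pos fun j _ => hv j
    have h3 : (∏ j, residueRatio b a j) * (∏ j, residueRatio b a j) ^ (θ - 1) =
        (∏ j, residueRatio b a j) ^ θ := by
      rw [Real.rpow_sub_one hp.ne', mul_div_cancel₀ _ hp.ne']
    rw [h3, h1, Real.div_rpow (Finset.prod_pos fun j _ => hw j).le (Real.rpow_nonneg (hw _).le _),
      ← Real.rpow_mul (hw _).le, Real.rpow_neg (inv_nonneg.2 (hw _).le),
      Real.inv_rpow (hw _).le, inv_inv, div_mul_cancel₀ _ (Real.rpow_pos_of_pos (hw _) _).ne']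
  rw [abs_det_residueJac hb h, div_mul_eq_mul_div, mul_right_comm, mul_right_comm _ (vdm b), h2,
    prod_residueWt hb h, Real.div_rpow hA.le (by positivity), daDens]
  have h4 : ∏ s, ∏ r, |b s - a r| ^ (θ - 1) = (∏ s, ∏ r, |b s - a r|) ^ (θ - 1) := by
    rw [← Real.finsetProd_rpow _ _ fun s _ => Finset.prod_nonneg fun r _ => abs_nonneg _]
    exact Finset.prod_congr rfl fun s _ => Real.finsetProd_rpow _ _ (fun r _ => abs_nonneg _) _
  rw [h4, Real.rpow_sub hA, Real.rpow_sub hV, Real.rpow_one, Real.rpow_one, Real.rpow_mul hV.le,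
    Real.rpow_two]
  ring

lemma isOpen_interlaces {n : ℕ} (b : Fin (n + 1) → ℝ) : IsOpen {a : Fin n → ℝ | Interlaces a b} := by
  simp only [Interlaces, Set.ofPred_forall]
  exact isOpen_iInter_of_finite fun i =>
    (isOpen_lt (continuous_apply i) continuous_const).inter
      (isOpen_lt continuous_const (continuous_apply i))

/-- The Dixon–Anderson change of variables. -/
lemma lintegral_daDens (θ : ℝ) {n : ℕ} {b : Fin (n + 1) → ℝ} (hb : StrictAnti b)
    (F : (Fin n → ℝ) → ℝ≥0∞) :
    ∫⁻ a in {a | Interlaces a b}, ENNReal.ofReal (daDens θ b a) * F (residueRatio b a) =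
      ∫⁻ v in {v : Fin n → ℝ | ∀ j, 0 < v j}, ENNReal.ofReal (dirichletDens θ v) * F v := by
  rw [← residueRatio_image hb, lintegral_image_eq_lintegral_abs_det_fderiv_mul volume
    (isOpen_interlaces b).measurableSet
    (fun a h => (hasFDerivAt_residueRatio hb h).hasFDerivWithinAt) (residueRatio_injOn hb)]
  refine setLIntegral_congr_fun (isOpen_interlaces b).measurableSet fun a h => ?_
  beta_reduce
  rw [← mul_assoc, ← ENNReal.ofReal_mul (abs_nonneg _), ← abs_det_mul_dirichletDens θ hb h]
  congr 4
  simp [ContinuousLinearMap.det]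

/-- The open positive orthant. -/
def orthant (n : ℕ) : Set (Fin n → ℝ) := {v | ∀ j, 0 < v j}

lemma orthant_eq_pi (n : ℕ) : orthant n = Set.pi Set.univ fun _ => Set.Ioi 0 := by
  ext; simp [orthant]

lemma measurableSet_orthant (n : ℕ) : MeasurableSet (orthant n) := by
  rw [orthant_eq_pi]
  exact MeasurableSet.univ_pi fun _ => measurableSet_Ioi

lemma lintegral_rpow_mul_exp {θ x : ℝ} (hθ : 0 < θ) (hx : 0 < x) :
    ∫⁻ t in Set.Ioi (0 : ℝ), ENNReal.ofReal (t ^ (θ - 1) * Real.exp (-(x * t))) =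
      ENNReal.ofReal (x ^ (-θ) * Real.Gamma θ) := by
  have hi : IntegrableOn (fun t : ℝ => t ^ (θ - 1) * Real.exp (-(x * t))) (Set.Ioi 0) := by
    have := integrableOn_rpow_mul_exp_neg_mul_rpow (s := θ - 1) (p := 1) (b := x) (by linarith)
      one_pos hx
    simpa using this
  rw [← ofReal_integral_eq_lintegral_ofReal hi, Real.integral_rpow_mul_exp_neg_mul_Ioi hθ hx,
    one_div, Real.inv_rpow hx.le, Real.rpow_neg hx.le]
  refine (ae_restrict_iff' measurableSet_Ioi).2 (ae_of_all _ fun t ht => ?_)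
  exact mul_nonneg (Real.rpow_nonneg (le_of_lt ht) _) (Real.exp_nonneg _)

lemma lintegral_orthant_prod {n : ℕ} {f : Fin n → ℝ → ℝ} (hf : ∀ j, Measurable (f j))
    (h0 : ∀ j, ∀ t, 0 < t → 0 ≤ f j t) :
    ∫⁻ v in orthant n, ENNReal.ofReal (∏ j, f j (v j)) =
      ∏ j, ∫⁻ t in Set.Ioi (0 : ℝ), ENNReal.ofReal (f j t) := by
  have h1 : ∀ v ∈ orthant n, ENNReal.ofReal (∏ j, f j (v j)) =
      ∏ j, ENNReal.ofReal (f j (v j)) := fun v hv =>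
    ENNReal.ofReal_prod_of_nonneg fun j _ => h0 j _ (hv j)
  rw [setLIntegral_congr_fun (measurableSet_orthant n) h1, orthant_eq_pi, volume_pi,
    Measure.restrict_pi_pi]
  clear h1
  induction n with
  | zero => simp
  | succ n ih =>
    rw [← ((measurePreserving_piFinSuccAbove (fun _ : Fin (n + 1) =>
      (volume : Measure ℝ).restrict (Set.Ioi 0)) 0).symm).lintegral_comp_emb
      (MeasurableEquiv.measurableEmbedding _)]
    simp_rw [MeasurableEquiv.piFinSuccAbove_symm_apply, Fin.insertNthEquiv,
      Fin.prod_univ_succ, Fin.insertNth_zero, Equiv.coe_fn_mk, Fin.cons_succ, cast_eq, Fin.cons_zero]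
    rw [lintegral_prod_mul (f := fun t => ENNReal.ofReal (f 0 t))
      (g := fun v : Fin n → ℝ => ∏ j, ENNReal.ofReal (f j.succ (v j))),
      ih (fun j => hf j.succ) (fun j => h0 j.succ)]
    · exact (hf 0).ennreal_ofReal.aemeasurable
    · exact (Finset.measurable_prod _ fun j _ =>
        ((hf j.succ).comp (measurable_pi_apply j)).ennreal_ofReal).aemeasurable

/-- The Dirichlet integral over the positive orthant. -/
lemma lintegral_dirichlet {θ : ℝ} (hθ : 0 < θ) {n : ℕ} {x₀ : ℝ} (hx₀ : 0 < x₀) {x : Fin n → ℝ}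
    (hx : ∀ j, 0 < x j) :
    ∫⁻ v in orthant n, ENNReal.ofReal ((∏ j, v j ^ (θ - 1)) *
        (x₀ + ∑ j, x j * v j) ^ (-((n + 1) * θ))) =
      ENNReal.ofReal (Real.Gamma θ ^ (n + 1) / Real.Gamma ((n + 1) * θ) *
        (x₀ ^ (-θ) * ∏ j, x j ^ (-θ))) := by
  have hp : 0 < (n + 1) * θ := by positivity
  have hG := Real.Gamma_pos_of_pos hp
  have hGθ := Real.Gamma_pos_of_pos hθ
  have key : ∫⁻ v in orthant n, ∫⁻ s in Set.Ioi (0 : ℝ), ENNReal.ofReal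
      (s ^ ((n + 1) * θ - 1) * Real.exp (-(x₀ * s)) *
        ∏ j, (v j ^ (θ - 1) * Real.exp (-((s * x j) * v j)))) =
      ENNReal.ofReal (Real.Gamma θ ^ (n + 1) * (x₀ ^ (-θ) * ∏ j, x j ^ (-θ))) := by
    rw [lintegral_lintegral_swap (Measurable.aemeasurable (by fun_prop))]
    have h1 : ∀ s ∈ Set.Ioi (0 : ℝ), ∫⁻ v in orthant n, ENNReal.ofReal
        (s ^ ((n + 1) * θ - 1) * Real.exp (-(x₀ * s)) *
          ∏ j, (v j ^ (θ - 1) * Real.exp (-((s * x j) * v j)))) =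
        ENNReal.ofReal (s ^ (θ - 1) * Real.exp (-(x₀ * s))) *
          ENNReal.ofReal (Real.Gamma θ ^ n * ∏ j, x j ^ (-θ)) := by
      intro s hs
      have hs' : 0 < s := hs
      have h2 : 0 ≤ s ^ ((n + 1) * θ - 1) * Real.exp (-(x₀ * s)) := by positivity
      simp_rw [ENNReal.ofReal_mul h2]
      rw [lintegral_const_mul' _ _ ENNReal.ofReal_ne_top,
        lintegral_orthant_prod (f := fun j t => t ^ (θ - 1) * Real.exp (-((s * x j) * t)))
          (fun j => by fun_prop)
          (fun j t ht => mul_nonneg (Real.rpow_nonneg ht.le _) (Real.exp_nonneg _))]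
      simp_rw [fun j => lintegral_rpow_mul_exp hθ (mul_pos hs' (hx j))]
      rw [← ENNReal.ofReal_prod_of_nonneg (fun j _ => mul_nonneg (Real.rpow_nonneg
        (mul_pos hs' (hx j)).le _) hGθ.le), ← ENNReal.ofReal_mul h2, ← ENNReal.ofReal_mul
        (by positivity)]
      congr 1
      simp_rw [fun j => Real.mul_rpow hs'.le (hx j).le (z := -θ)]
      rw [Finset.prod_mul_distrib, Finset.prod_mul_distrib, Finset.prod_const, Finset.prod_const,
        Finset.card_univ, Fintype.card_fin, ← Real.rpow_natCast (s ^ (-θ)), ← Real.rpow_mul hs'.le]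
      have h3 : s ^ (θ - 1) = s ^ ((n + 1) * θ - 1) * s ^ (-θ * n) := by
        rw [← Real.rpow_add hs']
        congr 1
        ring
      rw [h3]
      ring
    rw [setLIntegral_congr_fun measurableSet_Ioi h1, lintegral_mul_const' _ _ ENNReal.ofReal_ne_top,
      lintegral_rpow_mul_exp hθ hx₀, ← ENNReal.ofReal_mul (by positivity)]
    congr 1
    ring
  have h4 : ∀ v ∈ orthant n, ENNReal.ofReal ((∏ j, v j ^ (θ - 1)) *
        (x₀ + ∑ j, x j * v j) ^ (-((n + 1) * θ))) =
      ENNReal.ofReal ((Real.Gamma ((n + 1) * θ))⁻¹) *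
      ∫⁻ s in Set.Ioi (0 : ℝ), ENNReal.ofReal
      (s ^ ((n + 1) * θ - 1) * Real.exp (-(x₀ * s)) *
        ∏ j, (v j ^ (θ - 1) * Real.exp (-((s * x j) * v j)))) := by
    intro v hv
    have hS : 0 < x₀ + ∑ j, x j * v j := by
      have := Finset.sum_nonneg fun j (_ : j ∈ Finset.univ) => (mul_pos (hx j) (hv j)).le
      linarith
    have hP : 0 ≤ ∏ j, v j ^ (θ - 1) := Finset.prod_nonneg fun j _ => Real.rpow_nonneg (hv j).le _
    have h5 : ∀ s : ℝ, s ^ ((n + 1) * θ - 1) * Real.exp (-(x₀ * s)) *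
        ∏ j, (v j ^ (θ - 1) * Real.exp (-((s * x j) * v j))) =
        (∏ j, v j ^ (θ - 1)) * (s ^ ((n + 1) * θ - 1) *
          Real.exp (-((x₀ + ∑ j, x j * v j) * s))) := by
      intro s
      have h6 : Real.exp (-((x₀ + ∑ j, x j * v j) * s)) =
          Real.exp (-(x₀ * s)) * ∏ j, Real.exp (-((s * x j) * v j)) := by
        rw [← Real.exp_sum, ← Real.exp_add]
        congr 1
        rw [add_mul, neg_add, Finset.sum_mul, ← Finset.sum_neg_distrib]
        congr 1
        exact Finset.sum_congr rfl fun j _ => by ring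
      rw [Finset.prod_mul_distrib, h6]
      ring
    simp_rw [h5, ENNReal.ofReal_mul hP]
    rw [lintegral_const_mul' _ _ ENNReal.ofReal_ne_top, lintegral_rpow_mul_exp hp hS,
      ← ENNReal.ofReal_mul hP, ← ENNReal.ofReal_mul hP,
      ← ENNReal.ofReal_mul (inv_nonneg.2 hG.le)]
    congr 1
    field_simp
  rw [setLIntegral_congr_fun (measurableSet_orthant n) h4,
    lintegral_const_mul' _ _ ENNReal.ofReal_ne_top, key, ← ENNReal.ofReal_mul (inv_nonneg.2 hG.le)]
  congr 1
  field_simp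

lemma lintegral_orthant_scale {n : ℕ} {c : Fin n → ℝ} (hc : ∀ j, 0 < c j)
    (F : (Fin n → ℝ) → ℝ≥0∞) :
    ∫⁻ v in orthant n, F v =
      ∫⁻ u in orthant n, ENNReal.ofReal (∏ j, c j) * F (fun j => c j * u j) := by
  have himg : (Matrix.toLin' (Matrix.diagonal c)).toContinuousLinearMap '' orthant n = orthant n := by
    ext v
    refine ⟨?_, fun hv => ⟨fun j => v j / c j, fun j => div_pos (hv j) (hc j), ?_⟩⟩
    · rintro ⟨u, hu, rfl⟩ j
      simpa [Matrix.mulVec_diagonal] using mul_pos (hc j) (hu j)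
    · ext j
      have := (hc j).ne'
      simp [Matrix.mulVec_diagonal]
      field_simp
  conv_lhs => rw [← himg]
  rw [lintegral_image_eq_lintegral_abs_det_fderiv_mul volume (measurableSet_orthant n)
    (fun u _ => (ContinuousLinearMap.hasFDerivAt _).hasFDerivWithinAt)]
  · refine setLIntegral_congr_fun (measurableSet_orthant n) fun u _ => ?_
    have h1 : (Matrix.toLin' (Matrix.diagonal c)).toContinuousLinearMap u = fun j => c j * u j := by
      ext j
      simp [Matrix.mulVec_diagonal]
    have h2 : |(Matrix.toLin' (Matrix.diagonal c)).toContinuousLinearMap.det| = ∏ j, c j := by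
      simp [ContinuousLinearMap.det, Finset.abs_prod, fun j => abs_of_pos (hc j)]
    beta_reduce
    rw [h1, h2]
  · intro u _ u' _ h
    ext j
    have := congrFun h j
    simpa [Matrix.mulVec_diagonal, (hc j).ne'] using this

/-- The normalization of the Dirichlet density on the orthant. -/
def dirichletConst (θ : ℝ) (n : ℕ) : ℝ := Real.Gamma ((n + 1) * θ) / Real.Gamma θ ^ (n + 1)

lemma dirichletConst_pos {θ : ℝ} (hθ : 0 < θ) (n : ℕ) : 0 < dirichletConst θ n :=
  div_pos (Real.Gamma_pos_of_pos (by positivity)) (pow_pos (Real.Gamma_pos_of_pos hθ) _)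

/-- The barycenter of the nodes `b` with weights `(v, 1)`. -/
def baryMean {n : ℕ} (b : Fin (n + 1) → ℝ) (v : Fin n → ℝ) : ℝ :=
  (b (Fin.last n) + ∑ j, v j * b j.castSucc) / (1 + ∑ j, v j)

/-- The law of the mean of a Dirichlet random probability vector supported on the nodes `b`. -/
def dirichletMean (θ : ℝ) {n : ℕ} (b : Fin (n + 1) → ℝ) : Measure ℝ :=
  ENNReal.ofReal (dirichletConst θ n) • (((volume.restrict (orthant n)).withDensity
    fun v => ENNReal.ofReal (dirichletDens θ v)).map (baryMean b))

lemma measurable_baryMean {n : ℕ} (b : Fin (n + 1) → ℝ) : Measurable (baryMean b) := by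
  unfold baryMean
  fun_prop

lemma measurable_dirichletDens (θ : ℝ) (n : ℕ) :
    Measurable (dirichletDens θ : (Fin n → ℝ) → ℝ) := by
  unfold dirichletDens
  fun_prop

lemma lintegral_dirichletMean (θ : ℝ) {n : ℕ} (b : Fin (n + 1) → ℝ) {f : ℝ → ℝ≥0∞}
    (hf : Measurable f) :
    ∫⁻ t, f t ∂dirichletMean θ b = ENNReal.ofReal (dirichletConst θ n) *
      ∫⁻ v in orthant n, ENNReal.ofReal (dirichletDens θ v) * f (baryMean b v) := by
  rw [dirichletMean, lintegral_smul_measure, lintegral_map hf (measurable_baryMean b),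
    lintegral_withDensity_eq_lintegral_mul (g := fun v => f (baryMean b v)) _
      (measurable_dirichletDens θ n).ennreal_ofReal (hf.comp (measurable_baryMean b))]
  rfl

lemma one_add_sum_pos {n : ℕ} {v : Fin n → ℝ} (hv : v ∈ orthant n) : 0 < 1 + ∑ j, v j := by
  have := Finset.sum_nonneg fun j (_ : j ∈ Finset.univ) => (hv j).le
  linarith

lemma sub_baryMean_mul {n : ℕ} (b : Fin (n + 1) → ℝ) {v : Fin n → ℝ} (hv : v ∈ orthant n) (z : ℝ) :
    (z - baryMean b v) * (1 + ∑ j, v j) =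
      (z - b (Fin.last n)) + ∑ j, (z - b j.castSucc) * v j := by
  rw [baryMean, sub_mul, div_mul_cancel₀ _ (one_add_sum_pos hv).ne']
  simp_rw [sub_mul, Finset.sum_sub_distrib, ← Finset.mul_sum, mul_comm (b _)]
  ring

lemma baryMean_le {n : ℕ} {b : Fin (n + 1) → ℝ} (hb : StrictAnti b) {v : Fin n → ℝ}
    (hv : v ∈ orthant n) : baryMean b v ≤ b 0 := by
  have h := sub_baryMean_mul b hv (b 0)
  have h1 : 0 ≤ (b 0 - baryMean b v) * (1 + ∑ j, v j) := by
    rw [h]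
    exact add_nonneg (sub_nonneg.2 (hb.antitone (Fin.zero_le _))) (Finset.sum_nonneg fun j _ =>
      mul_nonneg (sub_nonneg.2 (hb.antitone (Fin.zero_le _))) (hv j).le)
  linarith [nonneg_of_mul_nonneg_left h1 (one_add_sum_pos hv)]

lemma le_baryMean {n : ℕ} {b : Fin (n + 1) → ℝ} (hb : StrictAnti b) {v : Fin n → ℝ}
    (hv : v ∈ orthant n) : b (Fin.last n) ≤ baryMean b v := by
  have h := sub_baryMean_mul b hv (b (Fin.last n))
  have h1 : 0 ≤ (baryMean b v - b (Fin.last n)) * (1 + ∑ j, v j) := by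
    rw [← neg_sub, neg_mul, h, sub_self, zero_add, neg_nonneg]
    exact Finset.sum_nonpos fun j _ =>
      mul_nonpos_of_nonpos_of_nonneg (sub_nonpos.2 (hb.antitone (Fin.le_last _))) (hv j).le
  linarith [nonneg_of_mul_nonneg_left h1 (one_add_sum_pos hv)]

lemma ae_dirichletMean_mem_Icc (θ : ℝ) {n : ℕ} {b : Fin (n + 1) → ℝ} (hb : StrictAnti b) :
    ∀ᵐ t ∂dirichletMean θ b, t ∈ Set.Icc (b (Fin.last n)) (b 0) := by
  refine Measure.ae_smul_measure ?_ _
  refine (ae_map_iff (p := (· ∈ Set.Icc (b (Fin.last n)) (b 0)))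
    (measurable_baryMean b).aemeasurable measurableSet_Icc).2 ?_
  refine (withDensity_absolutelyContinuous _ _).ae_le ?_
  exact (ae_restrict_iff' (measurableSet_orthant n)).2 (ae_of_all _ fun v hv =>
    ⟨le_baryMean hb hv, baryMean_le hb hv⟩)

/-- The Markov–Krein identity for the Dirichlet mean on the real half-line to the right of the
nodes. -/
lemma lintegral_sub_rpow_dirichletMean {θ : ℝ} (hθ : 0 < θ) {n : ℕ} {b : Fin (n + 1) → ℝ}
    (hb : StrictAnti b) {z : ℝ} (hz : b 0 < z) :
    ∫⁻ t, ENNReal.ofReal ((z - t) ^ (-((n + 1) * θ))) ∂dirichletMean θ b =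
      ENNReal.ofReal (∏ j, (z - b j) ^ (-θ)) := by
  have hzb : ∀ j, 0 < z - b j := fun j => by linarith [hb.antitone (Fin.zero_le j)]
  have hG := Real.Gamma_pos_of_pos (by positivity : 0 < (n + 1) * θ)
  have hGθ := Real.Gamma_pos_of_pos hθ
  rw [lintegral_dirichletMean θ b (by fun_prop)]
  have h1 : ∀ v ∈ orthant n, ENNReal.ofReal (dirichletDens θ v) *
      ENNReal.ofReal ((z - baryMean b v) ^ (-((n + 1) * θ))) =
      ENNReal.ofReal ((∏ j, v j ^ (θ - 1)) *
        ((z - b (Fin.last n)) + ∑ j, (z - b j.castSucc) * v j) ^ (-((n + 1) * θ))) := by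
    intro v hv
    have h2 : 0 ≤ z - baryMean b v := by linarith [baryMean_le hb hv]
    have h3 : 0 ≤ ∏ j, v j ^ (θ - 1) := Finset.prod_nonneg fun j _ => Real.rpow_nonneg (hv j).le _
    rw [← sub_baryMean_mul b hv, Real.mul_rpow h2 (one_add_sum_pos hv).le, dirichletDens,
      ← ENNReal.ofReal_mul (mul_nonneg h3 (Real.rpow_nonneg (one_add_sum_pos hv).le _))]
    congr 1
    ring
  rw [setLIntegral_congr_fun (measurableSet_orthant n) h1, lintegral_dirichlet hθ (hzb _)
    (fun j => hzb j.castSucc), ← ENNReal.ofReal_mul (dirichletConst_pos hθ n).le,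
    Fin.prod_univ_castSucc, dirichletConst]
  congr 1
  field_simp

lemma dirichletMean_univ {θ : ℝ} (hθ : 0 < θ) {n : ℕ} (b : Fin (n + 1) → ℝ) :
    dirichletMean θ b Set.univ = 1 := by
  have hG := Real.Gamma_pos_of_pos (by positivity : 0 < (n + 1) * θ)
  have hGθ := Real.Gamma_pos_of_pos hθ
  rw [← lintegral_one, lintegral_dirichletMean θ b measurable_const]
  have h := lintegral_dirichlet hθ (n := n) one_pos (x := fun _ => 1) (fun _ => one_pos)
  simp only [one_mul, Real.one_rpow, Finset.prod_const_one, mul_one] at h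
  simp only [mul_one, dirichletDens, h]
  rw [← ENNReal.ofReal_mul (dirichletConst_pos hθ n).le, dirichletConst, ← ENNReal.ofReal_one]
  congr 1
  field_simp

lemma lintegral_daDens_one {θ : ℝ} (hθ : 0 < θ) {n : ℕ} {b : Fin (n + 1) → ℝ} (hb : StrictAnti b) :
    ENNReal.ofReal (dirichletConst θ n) *
      ∫⁻ a in {a | Interlaces a b}, ENNReal.ofReal (daDens θ b a) = 1 := by
  have h := lintegral_daDens θ hb (fun _ => 1)
  have h1 := dirichletMean_univ hθ b
  rw [← lintegral_one, lintegral_dirichletMean θ b measurable_const] at h1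
  simp only [mul_one] at h h1
  rw [h]
  exact h1

/-- Averaging `∏ (z - aᵢ)^{-θ}` over the Dixon–Anderson kernel gives a transform of the Dirichlet
mean. -/
lemma lintegral_daDens_prod_sub {θ : ℝ} {n : ℕ} {b : Fin (n + 1) → ℝ}
    (hb : StrictAnti b) {z : ℝ} (hz : b 0 < z) :
    ENNReal.ofReal (dirichletConst θ n) * ∫⁻ a in {a | Interlaces a b},
        ENNReal.ofReal (daDens θ b a) * ENNReal.ofReal (∏ i, (z - a i) ^ (-θ)) =
      ∫⁻ t, ENNReal.ofReal ((z - t) ^ (-(n * θ))) ∂dirichletMean θ b := by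
  have hzb : ∀ j, 0 < z - b j := fun j => by linarith [hb.antitone (Fin.zero_le j)]
  have hL := hzb (Fin.last n)
  rw [lintegral_dirichletMean θ b (by fun_prop)]
  congr 1
  set G : (Fin n → ℝ) → ℝ := fun v => (∏ j, (z - b j)) *
    (∑ j, v j / (z - b j.castSucc) + 1 / (z - b (Fin.last n))) / (1 + ∑ j, v j) with hGdef
  have h1 : ∀ a ∈ {a | Interlaces a b}, ENNReal.ofReal (daDens θ b a) *
      ENNReal.ofReal (∏ i, (z - a i) ^ (-θ)) = ENNReal.ofReal (daDens θ b a) *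
      ENNReal.ofReal (G (residueRatio b a) ^ (-θ)) := by
    intro a h
    have ha : ∀ i, 0 < z - a i := fun i => by
      linarith [(h i).1, hb.antitone (Fin.zero_le i.castSucc)]
    rw [Real.finsetProd_rpow _ _ fun i _ => (ha i).le, prod_sub_eq_sum hb.injective a
      fun j => (hzb j).ne', hGdef]
    beta_reduce
    rw [one_add_sum_residueRatio hb h, Fin.sum_univ_castSucc]
    have hw := residueWt_pos hb h (Fin.last n)
    congr 3
    rw [div_inv_eq_mul, mul_assoc]
    congr 1
    rw [add_mul, Finset.sum_mul]
    congr 1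
    · refine Finset.sum_congr rfl fun j _ => ?_
      rw [residueRatio]
      field_simp
    · field_simp
  rw [setLIntegral_congr_fun (isOpen_interlaces b).measurableSet h1,
    lintegral_daDens θ hb (fun v => ENNReal.ofReal (G v ^ (-θ)))]
  change ∫⁻ v in orthant n, _ = _
  have hc : ∀ j : Fin n, 0 < (z - b j.castSucc) / (z - b (Fin.last n)) :=
    fun j => div_pos (hzb _) hL
  rw [lintegral_orthant_scale hc]
  refine setLIntegral_congr_fun (measurableSet_orthant n) fun u hu => ?_
  have hS := one_add_sum_pos hu
  set c : Fin n → ℝ := fun j => (z - b j.castSucc) / (z - b (Fin.last n)) with hcdef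
  have hT : 0 < 1 + ∑ j, c j * u j := one_add_sum_pos fun j => mul_pos (hc j) (hu j)
  have hC : 0 < ∏ j, c j := Finset.prod_pos fun j _ => hc j
  have hU : 0 < ∏ j, u j := Finset.prod_pos fun j _ => hu j
  have hZ : z - baryMean b u = (z - b (Fin.last n)) * (1 + ∑ j, c j * u j) / (1 + ∑ j, u j) := by
    rw [eq_div_iff hS.ne', sub_baryMean_mul b hu, mul_add, mul_one, Finset.mul_sum]
    congr 1
    refine Finset.sum_congr rfl fun j _ => ?_
    rw [hcdef]
    field_simp
  have hGu : G (fun j => c j * u j) =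
      (∏ j, c j) * (z - b (Fin.last n)) ^ n * (1 + ∑ j, u j) / (1 + ∑ j, c j * u j) := by
    rw [hGdef]
    beta_reduce
    congr 1
    have h2 : ∑ j, c j * u j / (z - b j.castSucc) + 1 / (z - b (Fin.last n)) =
        (1 + ∑ j, u j) / (z - b (Fin.last n)) := by
      rw [add_comm, add_div, Finset.sum_div]
      congr 1
      refine Finset.sum_congr rfl fun j _ => ?_
      have := (hzb j.castSucc).ne'
      rw [hcdef]
      field_simp
    rw [h2, Fin.prod_univ_castSucc, hcdef, Finset.prod_div_distrib, Finset.prod_const,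
      Finset.card_univ, Fintype.card_fin]
    field_simp
  rw [hGu, hZ, ← ENNReal.ofReal_mul, ← ENNReal.ofReal_mul hC.le, ← ENNReal.ofReal_mul]
  · congr 1
    rw [dirichletDens, dirichletDens, Real.finsetProd_rpow _ _ fun j _ => (hu j).le,
      Real.finsetProd_rpow _ _ fun j _ => (mul_pos (hc j) (hu j)).le, Finset.prod_mul_distrib]
    have hLn : 0 < (z - b (Fin.last n)) ^ n := pow_pos hL n
    rw [Real.mul_rpow hC.le hU.le, Real.div_rpow (by positivity) hT.le,
      Real.div_rpow (by positivity) hS.le, Real.mul_rpow (by positivity) hS.le,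
      Real.mul_rpow hC.le hLn.le, Real.mul_rpow hL.le hT.le, ← Real.rpow_natCast_mul hL.le,
      Real.rpow_sub_one hC.ne', Real.rpow_neg hC.le θ]
    have e1 : (1 + ∑ j, c j * u j) ^ (-((n + 1) * θ)) =
        (1 + ∑ j, c j * u j) ^ (-(n * θ)) * (1 + ∑ j, c j * u j) ^ (-θ) := by
      rw [← Real.rpow_add hT]; congr 1; ring
    have e2 : (1 + ∑ j, u j) ^ (-((n + 1) * θ)) =
        (1 + ∑ j, u j) ^ (-(n * θ)) * (1 + ∑ j, u j) ^ (-θ) := by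
      rw [← Real.rpow_add hS]; congr 1; ring
    rw [e1, e2, mul_neg]
    have := (Real.rpow_pos_of_pos hC θ).ne'
    have := (Real.rpow_pos_of_pos hT (-θ)).ne'
    have := (Real.rpow_pos_of_pos hS (-(n * θ))).ne'
    field_simp
  · exact mul_nonneg (Finset.prod_nonneg fun j _ => Real.rpow_nonneg (hu j).le _)
      (Real.rpow_nonneg hS.le _)
  · exact mul_nonneg (Finset.prod_nonneg fun j _ => Real.rpow_nonneg (mul_pos (hc j) (hu j)).le _)
      (Real.rpow_nonneg hT.le _)

/-- Append a new top level to a triangular array. -/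
def triSnoc {n : ℕ} (p : Tri n × (Fin (n + 1) → ℝ)) : Tri (n + 1) :=
  Fin.snoc (α := fun k : Fin (n + 1) => Fin (k.1 + 1) → ℝ) p.1 p.2

lemma triSnoc_castSucc {n : ℕ} (p : Tri n × (Fin (n + 1) → ℝ)) (k : Fin n) :
    triSnoc p k.castSucc = p.1 k :=
  Fin.snoc_castSucc (α := fun k : Fin (n + 1) => Fin (k.1 + 1) → ℝ) _ _ _

lemma triSnoc_last {n : ℕ} (p : Tri n × (Fin (n + 1) → ℝ)) :
    triSnoc p (Fin.last n) = p.2 :=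
  Fin.snoc_last (α := fun k : Fin (n + 1) => Fin (k.1 + 1) → ℝ) _ _

lemma measurable_triSnoc (n : ℕ) : Measurable (triSnoc (n := n)) := by
  refine measurable_pi_lambda _ fun k => ?_
  refine Fin.lastCases ?_ (fun k => ?_) k
  · simp_rw [triSnoc_last]
    exact measurable_snd
  · simp_rw [triSnoc_castSucc]
    exact (measurable_pi_apply k).comp measurable_fst

lemma measurePreserving_triSnoc (n : ℕ) :
    MeasurePreserving (triSnoc (n := n)) ((volume : Measure (Tri n)).prod volume)
      (volume : Measure (Tri (n + 1))) := by
  refine ⟨measurable_triSnoc n, Eq.symm ?_⟩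
  rw [volume_pi]
  refine Measure.pi_eq fun s hs => ?_
  rw [Measure.map_apply (measurable_triSnoc n) (MeasurableSet.univ_pi hs)]
  have h : triSnoc (n := n) ⁻¹' (Set.pi Set.univ s) =
      (Set.pi Set.univ fun k : Fin n => s k.castSucc) ×ˢ s (Fin.last n) := by
    ext p
    simp only [Set.mem_preimage, Set.mem_pi, Set.mem_univ, true_imp_iff, Set.mem_prod,
      Fin.forall_fin_succ', triSnoc_last]
    simp only [triSnoc_castSucc]
  rw [h, Measure.prod_prod, Fin.prod_univ_castSucc, volume_pi, Measure.pi_pi]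

lemma lvl_triSnoc {n : ℕ} (b : Fin (n + 2) → ℝ) (p : Tri n × (Fin (n + 1) → ℝ)) (k : ℕ)
    (hk : k < n + 1) (hk' : k < n + 2) : lvl b (triSnoc p) k hk' = lvl p.2 p.1 k hk := by
  have h1 : k < n + 2 - 1 := hk
  funext i
  rw [lvl, dif_pos h1, lvl]
  split_ifs with h
  · exact congrFun (triSnoc_castSucc p ⟨k, h⟩) i
  · obtain rfl : k = n := by omega
    exact congrFun (triSnoc_last p) i

lemma lvl_top {n : ℕ} (b : Fin (n + 1) → ℝ) (x : Tri n) (hk : n < n + 1) :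
    lvl b x n hk = b := by
  have h1 : ¬ n < n + 1 - 1 := by simp
  rw [lvl, dif_neg h1]

lemma triSnoc_mem_obpDomain {n : ℕ} (b : Fin (n + 2) → ℝ) (p : Tri n × (Fin (n + 1) → ℝ)) :
    triSnoc p ∈ obpDomain b ↔ Interlaces p.2 b ∧ p.1 ∈ obpDomain p.2 := by
  change (∀ k : Fin (n + 1), Interlaces (triSnoc p k) (lvl b (triSnoc p) (k.1 + 1) _)) ↔ _
  rw [Fin.forall_fin_succ', and_comm]
  refine and_congr ?_ (forall_congr' fun k => ?_)
  · rw [triSnoc_last]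
    exact iff_of_eq (congrArg _ (lvl_top b (triSnoc p) _))
  · rw [triSnoc_castSucc]
    exact iff_of_eq (congrArg _ (lvl_triSnoc b p (k.1 + 1) (by omega) _))

lemma obpWt_triSnoc (θ : ℝ) {n : ℕ} (b : Fin (n + 2) → ℝ) (p : Tri n × (Fin (n + 1) → ℝ)) :
    obpWt θ b (triSnoc p) = obpWt θ p.2 p.1 *
      ((∏ i, ∏ j, if i < j then |p.2 i - p.2 j| ^ (2 - 2 * θ) else 1) *
        ∏ s, ∏ r, |b s - p.2 r| ^ (θ - 1)) := by
  rw [obpWt]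
  change (∏ k : Fin (n + 1), _) = _
  rw [Fin.prod_univ_castSucc]
  congr 1
  · refine Finset.prod_congr rfl fun k _ => ?_
    have e1 := triSnoc_castSucc p k
    have e2 := lvl_triSnoc b p (k.1 + 1) (by omega) (by omega)
    change (_ * ∏ s : Fin (k.1 + 2), ∏ r : Fin (k.1 + 1),
      |lvl b (triSnoc p) (k.1 + 1) _ s - triSnoc p k.castSucc r| ^ (θ - 1)) = _
    rw [e1, e2]
    rfl
  · have e2 := lvl_top b (triSnoc p) (by omega)
    change (_ * ∏ s : Fin (n + 2), ∏ r : Fin (n + 1),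
      |lvl b (triSnoc p) (n + 1) _ s - triSnoc p (Fin.last n) r| ^ (θ - 1)) = _
    rw [triSnoc_last, e2]
    rfl

lemma measurable_lvl {N : ℕ} (b : Fin N → ℝ) (k : ℕ) (hk : k < N) (i : Fin (k + 1)) :
    Measurable fun x => lvl b x k hk i := by
  unfold lvl
  split_ifs
  · fun_prop
  · fun_prop

lemma measurable_obpWt (θ : ℝ) {N : ℕ} (b : Fin N → ℝ) : Measurable (obpWt θ b) := by
  unfold obpWt
  refine Finset.measurable_prod _ fun k _ => Measurable.mul ?_ ?_
  · refine Finset.measurable_prod _ fun i _ => Finset.measurable_prod _ fun j _ => ?_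
    split_ifs <;> fun_prop
  · refine Finset.measurable_prod _ fun s _ => Finset.measurable_prod _ fun r _ => ?_
    have := measurable_lvl b (k.1 + 1) (by omega) s
    fun_prop

lemma measurableSet_obpDomain {N : ℕ} (b : Fin N → ℝ) : MeasurableSet (obpDomain b) := by
  simp only [obpDomain, Interlaces, Set.ofPred_forall, Set.ofPred_and]
  refine MeasurableSet.iInter fun k => MeasurableSet.iInter fun i => MeasurableSet.inter ?_ ?_
  · exact measurableSet_lt (by fun_prop) (measurable_lvl b (k.1 + 1) (by omega) _)
  · exact measurableSet_lt (measurable_lvl b (k.1 + 1) (by omega) _) (by fun_prop)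

lemma obpWt_nonneg (θ : ℝ) {N : ℕ} (b : Fin N → ℝ) (x : Tri (N - 1)) : 0 ≤ obpWt θ b x := by
  refine Finset.prod_nonneg fun k _ => mul_nonneg ?_ ?_
  · refine Finset.prod_nonneg fun i _ => Finset.prod_nonneg fun j _ => ?_
    split_ifs <;> positivity
  · exact Finset.prod_nonneg fun i _ => Finset.prod_nonneg fun j _ => by positivity

/-- The normalization of the orbital beta process with `n + 1` particles on the top level. -/
def obpConst (θ : ℝ) (n : ℕ) : ℝ :=
  (∏ k : Fin (n + 1), Real.Gamma ((k.1 + 1) * θ)) / Real.Gamma θ ^ ((n + 1) * (n + 1 + 1) / 2)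

lemma obpConst_pos {θ : ℝ} (hθ : 0 < θ) (n : ℕ) : 0 < obpConst θ n :=
  div_pos (Finset.prod_pos fun _ _ => Real.Gamma_pos_of_pos (by positivity))
    (pow_pos (Real.Gamma_pos_of_pos hθ) _)

lemma obpConst_succ (θ : ℝ) (n : ℕ) :
    obpConst θ (n + 1) = obpConst θ n * dirichletConst θ (n + 1) := by
  have h : (n + 1 + 1) * (n + 1 + 1 + 1) / 2 = (n + 1) * (n + 1 + 1) / 2 + (n + 1 + 1) := by
    rw [show (n + 1 + 1) * (n + 1 + 1 + 1) = (n + 1) * (n + 1 + 1) + (n + 1 + 1) * 2 by ring,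
      Nat.add_mul_div_right _ _ two_pos]
  rw [obpConst, obpConst, dirichletConst, h, pow_add, Fin.prod_univ_castSucc, div_mul_div_comm]
  simp

/-- The law of the single particle on the bottom level of the orbital beta process. -/
def bottomLaw (θ : ℝ) {n : ℕ} (b : Fin (n + 1) → ℝ) : Measure ℝ :=
  ENNReal.ofReal (obpConst θ n * vdm b ^ (1 - 2 * θ)) •
    (((volume.restrict (obpDomain b)).withDensity fun x => ENNReal.ofReal (obpWt θ b x)).map
      fun x => lvl b x 0 n.succ_pos 0)

lemma lintegral_bottomLaw (θ : ℝ) {n : ℕ} (b : Fin (n + 1) → ℝ) {f : ℝ → ℝ≥0∞}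
    (hf : Measurable f) :
    ∫⁻ t, f t ∂bottomLaw θ b = ENNReal.ofReal (obpConst θ n * vdm b ^ (1 - 2 * θ)) *
      ∫⁻ x in obpDomain b, ENNReal.ofReal (obpWt θ b x) * f (lvl b x 0 n.succ_pos 0) := by
  rw [bottomLaw, lintegral_smul_measure, lintegral_map hf (measurable_lvl b 0 _ 0),
    lintegral_withDensity_eq_lintegral_mul (g := fun x => f (lvl b x 0 n.succ_pos 0)) _
      (measurable_obpWt θ b).ennreal_ofReal (hf.comp (measurable_lvl b 0 _ 0))]
  rfl

lemma lintegral_bottomLaw_succ {θ : ℝ} (hθ : 0 < θ) {n : ℕ} {b : Fin (n + 2) → ℝ}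
    (hb : StrictAnti b) {f : ℝ → ℝ≥0∞} (hf : Measurable f) :
    ∫⁻ t, f t ∂bottomLaw θ b = ENNReal.ofReal (dirichletConst θ (n + 1)) *
      ∫⁻ a in {a | Interlaces a b}, ENNReal.ofReal (daDens θ b a) *
        ∫⁻ t, f t ∂bottomLaw θ a := by
  have hV := vdm_pos hb.injective
  have hc := obpConst_pos hθ n
  have hd := dirichletConst_pos hθ (n + 1)
  rw [lintegral_bottomLaw θ b hf, obpConst_succ, ← lintegral_indicator (measurableSet_obpDomain b)]
  set g : Tri (n + 1) → ℝ≥0∞ := (obpDomain b).indicator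
    fun x => ENNReal.ofReal (obpWt θ b x) * f (lvl b x 0 (n + 1).succ_pos 0) with hg
  have hgm : Measurable g := Measurable.indicator
    ((measurable_obpWt θ b).ennreal_ofReal.mul (hf.comp (measurable_lvl b 0 _ 0)))
    (measurableSet_obpDomain b)
  change _ * ∫⁻ x : Tri (n + 1), g x = _
  rw [← (measurePreserving_triSnoc n).lintegral_comp hgm,
    lintegral_prod_symm (fun p => g (triSnoc p)) (hgm.comp (measurable_triSnoc n)).aemeasurable,
    ← lintegral_indicator (isOpen_interlaces b).measurableSet,
    ← lintegral_const_mul' _ _ ENNReal.ofReal_ne_top,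
    ← lintegral_const_mul' _ _ ENNReal.ofReal_ne_top]
  refine lintegral_congr fun a => ?_
  by_cases ha : Interlaces a b
  · have hVa := vdm_pos (ha.strictAnti hb).injective
    have hA : 0 ≤ ∏ s, ∏ r, |b s - a r| ^ (θ - 1) :=
      Finset.prod_nonneg fun _ _ => Finset.prod_nonneg fun _ _ => by positivity
    rw [Set.indicator_of_mem (by exact ha), lintegral_bottomLaw θ a hf]
    have h1 : ∀ x : Tri n, g (triSnoc (x, a)) = ENNReal.ofReal
        (vdm a ^ (2 - 2 * θ) * ∏ s, ∏ r, |b s - a r| ^ (θ - 1)) *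
        (obpDomain a).indicator
          (fun x => ENNReal.ofReal (obpWt θ a x) * f (lvl a x 0 n.succ_pos 0)) x := by
      intro x
      have hmem := triSnoc_mem_obpDomain b (x, a)
      by_cases hx : x ∈ obpDomain a
      · rw [hg, Set.indicator_of_mem (by exact hmem.2 ⟨ha, hx⟩), Set.indicator_of_mem hx,
          obpWt_triSnoc, lvl_triSnoc b (x, a) 0 n.succ_pos, ENNReal.ofReal_mul (obpWt_nonneg _ _ _),
          vdm_rpow]
        ring
      · rw [hg, Set.indicator_of_notMem (by exact fun h => hx (hmem.1 h).2),
          Set.indicator_of_notMem hx, mul_zero]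
    simp_rw [h1]
    rw [lintegral_const_mul' _ _ ENNReal.ofReal_ne_top,
      ← lintegral_indicator (measurableSet_obpDomain a), ← mul_assoc, ← mul_assoc, ← mul_assoc,
      ← ENNReal.ofReal_mul (by positivity), ← ENNReal.ofReal_mul hd.le,
      ← ENNReal.ofReal_mul (mul_nonneg hd.le (by unfold daDens; positivity)), daDens]
    have e : vdm a ^ (2 - 2 * θ) = vdm a * vdm a ^ (1 - 2 * θ) := by
      nth_rewrite 2 [← Real.rpow_one (vdm a)]
      rw [← Real.rpow_add hVa]
      congr 1; ring
    rw [e]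
    congr 2
    ring
  · rw [Set.indicator_of_notMem (by exact ha), mul_zero]
    have h1 : ∀ x : Tri n, g (triSnoc (x, a)) = 0 := fun x =>
      Set.indicator_of_notMem (by exact fun h => ha ((triSnoc_mem_obpDomain b (x, a)).1 h).1) _
    simp [h1]

/-- Differentiability of an exponential transform with respect to its complex parameter. -/
lemma differentiableAt_integral_exp_mul {α : Type*} [MeasurableSpace α] {μ : Measure α}
    {ζ g : α → ℂ} (hζ : AEStronglyMeasurable ζ μ) (hg : AEStronglyMeasurable g μ) {y : ℂ} {δ : ℝ}
    (hδ : 0 < δ)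
    (hint : Integrable (fun a => Real.exp ((y * ζ a).re + δ * ‖ζ a‖) * ‖g a‖) μ) :
    DifferentiableAt ℂ (fun w => ∫ a, Complex.exp (w * ζ a) * g a ∂μ) y := by
  have hexp : ∀ w : ℂ, AEStronglyMeasurable (fun a => Complex.exp (w * ζ a)) μ := fun w =>
    Complex.continuous_exp.comp_aestronglyMeasurable (hζ.const_mul w)
  have hre : ∀ w ∈ Metric.ball y (δ / 2), ∀ a, (w * ζ a).re ≤ (y * ζ a).re + δ / 2 * ‖ζ a‖ := by
    intro w hw a
    have h1 : (w * ζ a).re = (y * ζ a).re + ((w - y) * ζ a).re := by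
      rw [← Complex.add_re]; ring_nf
    have h2 : ((w - y) * ζ a).re ≤ ‖w - y‖ * ‖ζ a‖ :=
      (Complex.re_le_norm _).trans (norm_mul_le _ _)
    have h3 : ‖w - y‖ ≤ δ / 2 := (mem_ball_iff_norm.1 hw).le
    nlinarith [norm_nonneg (ζ a)]
  refine (hasDerivAt_integral_of_dominated_loc_of_deriv_le (𝕜 := ℂ)
    (F' := fun w a => ζ a * Complex.exp (w * ζ a) * g a)
    (bound := fun a => 2 / δ * (Real.exp ((y * ζ a).re + δ * ‖ζ a‖) * ‖g a‖))
    (Metric.ball_mem_nhds y (half_pos hδ)) (Eventually.of_forall fun w => (hexp w).mul hg) ?_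
    ((hζ.mul (hexp y)).mul hg) (ae_of_all _ fun a w hw => ?_) (hint.const_mul _)
    (ae_of_all _ fun a w hw => ?_)).2.differentiableAt
  · refine hint.mono ((hexp y).mul hg) (ae_of_all _ fun a => ?_)
    rw [Pi.mul_apply]
    rw [norm_mul, norm_mul, Complex.norm_exp, Real.norm_of_nonneg (Real.exp_nonneg _), norm_norm]
    gcongr
    have := mul_nonneg hδ.le (norm_nonneg (ζ a))
    linarith
  · rw [norm_mul, norm_mul, Complex.norm_exp, ← mul_assoc]
    refine mul_le_mul_of_nonneg_right ?_ (norm_nonneg _)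
    have h1 : ‖ζ a‖ ≤ 2 / δ * Real.exp (δ / 2 * ‖ζ a‖) := by
      have := Real.add_one_le_exp (δ / 2 * ‖ζ a‖)
      rw [div_mul_eq_mul_div, le_div_iff₀ hδ]
      linarith
    calc ‖ζ a‖ * Real.exp (w * ζ a).re
        ≤ (2 / δ * Real.exp (δ / 2 * ‖ζ a‖)) * Real.exp ((y * ζ a).re + δ / 2 * ‖ζ a‖) := by
          gcongr
          exact hre w hw a
      _ = 2 / δ * Real.exp ((y * ζ a).re + δ * ‖ζ a‖) := by
          rw [mul_assoc, ← Real.exp_add]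
          ring_nf
  · have h := (((hasDerivAt_id w).mul_const (ζ a)).cexp).mul_const (g a)
    simpa [mul_comm] using h

/-- Cauchy's theorem for a half-strip extending to `-∞`. -/
lemma integral_halfStrip_boundary {f : ℂ → ℂ} {M k C α β : ℝ} (hk : 0 < k) (hαβ : α ≤ β)
    (hf : ∀ z : ℂ, z.re ≤ M → z.im ∈ Set.Icc α β → DifferentiableAt ℂ f z)
    (hC : ∀ z : ℂ, z.re ≤ M → z.im ∈ Set.Icc α β → ‖f z‖ ≤ C * Real.exp (k * z.re)) :
    (∫ x in Set.Iic M, f (x + α * Complex.I)) - (∫ x in Set.Iic M, f (x + β * Complex.I)) +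
      Complex.I * ∫ s in α..β, f (M + s * Complex.I) = 0 := by
  have hint : ∀ s ∈ Set.Icc α β,
      IntegrableOn (fun x : ℝ => f (x + s * Complex.I)) (Set.Iic M) := by
    intro s hs
    refine Integrable.mono' ((integrableOn_exp_mul_Iic hk M).const_mul C) ?_ ?_
    · refine ContinuousOn.aestronglyMeasurable (fun x hx => ?_) measurableSet_Iic
      refine ContinuousAt.continuousWithinAt (ContinuousAt.comp (g := f) ?_ (by fun_prop))
      exact (hf _ (by simpa using hx) (by simpa using hs)).continuousAt
    · refine (ae_restrict_iff' measurableSet_Iic).2 (ae_of_all _ fun x hx => ?_)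
      simpa using hC (x + s * Complex.I) (by simpa using hx) (by simpa using hs)
  have h1 := fun s hs => intervalIntegral_tendsto_integral_Iic M (hint s hs) tendsto_id
  have h2 : Tendsto (fun T : ℝ => ∫ s in α..β, f (T + s * Complex.I)) atBot (𝓝 0) := by
    have h3 : Tendsto (fun T : ℝ => C * Real.exp (k * T) * |β - α|) atBot (𝓝 0) := by
      have := (Real.tendsto_exp_atBot.comp (tendsto_id.const_mul_atBot hk)).const_mul C
      simpa using this.mul_const |β - α|
    refine squeeze_zero_norm' ?_ h3
    filter_upwards [eventually_le_atBot M] with T hT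
    refine intervalIntegral.norm_integral_le_of_norm_le_const fun s hs => ?_
    rw [Set.uIoc_of_le hαβ] at hs
    simpa using hC (T + s * Complex.I) (by simpa using hT) (by simpa using ⟨hs.1.le, hs.2⟩)
  have h4 : ∀ T ≤ M, (∫ x in T..M, f (x + α * Complex.I)) - (∫ x in T..M, f (x + β * Complex.I)) +
      Complex.I * (∫ s in α..β, f (M + s * Complex.I)) -
      Complex.I * (∫ s in α..β, f (T + s * Complex.I)) = 0 := by
    intro T hT
    have := Complex.integral_boundary_rect_eq_zero_of_differentiableOn f (T + α * Complex.I)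
      (M + β * Complex.I) ?_
    · simpa using this
    · intro z hz
      simp only [Complex.mem_reProdIm, Complex.add_re, Complex.ofReal_re, Complex.mul_re,
        Complex.I_re, Complex.ofReal_im, Complex.I_im, Complex.add_im, Complex.mul_im, mul_zero,
        mul_one, sub_self, add_zero, zero_add, Set.uIcc_of_le hT, Set.uIcc_of_le hαβ] at hz
      exact (hf z hz.1.2 hz.2).differentiableWithinAt
  have h5 := (((h1 α ⟨le_rfl, hαβ⟩).sub (h1 β ⟨hαβ, le_rfl⟩)).add_const
    (Complex.I * ∫ s in α..β, f (M + s * Complex.I))).sub (h2.const_mul Complex.I)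
  rw [mul_zero, sub_zero] at h5
  refine tendsto_nhds_unique h5 (tendsto_const_nhds.congr' ?_)
  filter_upwards [eventually_le_atBot M] with T hT
  exact (h4 T hT).symm

/-- Holomorphic functions that agree on a real interval agree on the whole domain. -/
lemma eqOn_of_eq_ofReal {U : Set ℂ} (hU : IsOpen U) (hc : IsPreconnected U) {f g : ℂ → ℂ}
    (hf : DifferentiableOn ℂ f U) (hg : DifferentiableOn ℂ g U) {x₀ : ℝ} (hx₀ : (x₀ : ℂ) ∈ U)
    (h : ∀ x : ℝ, x₀ < x → f x = g x) : Set.EqOn f g U := by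
  refine (hf.analyticOnNhd hU).eqOn_of_preconnected_of_frequently_eq (hg.analyticOnNhd hU) hc hx₀ ?_
  have h1 : Tendsto (fun x : ℝ => (x : ℂ)) (𝓝[>] x₀) (𝓝[≠] (x₀ : ℂ)) := by
    refine tendsto_nhdsWithin_iff.2 ⟨?_, ?_⟩
    · exact (Complex.continuous_ofReal.tendsto x₀).mono_left nhdsWithin_le_nhds
    · filter_upwards [self_mem_nhdsWithin] with x hx
      simpa using (ne_of_gt hx)
  refine h1.frequently (Eventually.frequently ?_)
  filter_upwards [self_mem_nhdsWithin] with x hx using h x hx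

lemma eq_of_eq_ofReal_of_re_pos {f g : ℂ → ℂ} (hf : ∀ z : ℂ, 0 < z.re → DifferentiableAt ℂ f z)
    (hg : ∀ z : ℂ, 0 < z.re → DifferentiableAt ℂ g z) (h : ∀ x : ℝ, 0 < x → f x = g x) {z : ℂ}
    (hz : 0 < z.re) : f z = g z := by
  refine eqOn_of_eq_ofReal (U := {z | 0 < z.re}) (x₀ := 1)
    (isOpen_lt continuous_const Complex.continuous_re) (convex_halfSpace_re_gt 0).isPreconnected
    (fun z hz => (hf z hz).differentiableWithinAt) (fun z hz => (hg z hz).differentiableWithinAt)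
    (by simp) (fun x hx => h x (by linarith)) hz

lemma mem_slitPlane_of_re_pos {z : ℂ} (hz : 0 < z.re) : z ∈ Complex.slitPlane := Or.inl hz

lemma integral_exp_mul_rpow {s : ℝ} (hs : 0 < s) {w : ℂ} (hw : 0 < w.re) :
    ∫ x in Set.Ioi (0 : ℝ), Complex.exp (w * -(x : ℂ)) * ((x ^ (s - 1) : ℝ) : ℂ) =
      w ^ (-s : ℂ) * Real.Gamma s := by
  refine eq_of_eq_ofReal_of_re_pos
    (f := fun w => ∫ x in Set.Ioi (0 : ℝ), Complex.exp (w * -(x : ℂ)) * ((x ^ (s - 1) : ℝ) : ℂ))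
    (g := fun w => w ^ (-s : ℂ) * Real.Gamma s) (fun z hz => ?_) (fun z hz => ?_) (fun x hx => ?_) hw
  · refine differentiableAt_integral_exp_mul (δ := z.re / 2) ?_ ?_ (by positivity) ?_
    · exact (by fun_prop : Measurable fun x : ℝ => -(x : ℂ)).aestronglyMeasurable
    · exact (by fun_prop : Measurable fun x : ℝ => ((x ^ (s - 1) : ℝ) : ℂ)).aestronglyMeasurable
    · have h := integrableOn_rpow_mul_exp_neg_mul_rpow (s := s - 1) (p := 1) (b := z.re / 2)
        (by linarith) one_pos (by positivity)
      refine h.congr_fun (fun x hx => ?_) measurableSet_Ioi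
      have hx' : 0 < x := hx
      simp only [Real.rpow_one, norm_neg, Complex.norm_real, Real.norm_of_nonneg hx'.le,
        Real.norm_of_nonneg (Real.rpow_nonneg hx'.le _)]
      rw [mul_comm]
      congr 2
      simp
      ring
  · exact ((differentiableAt_id.cpow_const (mem_slitPlane_of_re_pos hz)).mul_const _)
  · have h := Real.integral_rpow_mul_exp_neg_mul_Ioi hs hx
    have h2 : ∀ t : ℝ, Complex.exp (x * -(t : ℂ)) * ((t ^ (s - 1) : ℝ) : ℂ) =
        ((t ^ (s - 1) * Real.exp (-(x * t)) : ℝ) : ℂ) := fun t => by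
      push_cast
      rw [mul_comm, mul_neg]
    simp_rw [h2]
    rw [integral_complex_ofReal, h, one_div, Real.inv_rpow hx.le, ← Real.rpow_neg hx.le]
    push_cast
    rw [Complex.ofReal_cpow hx.le]
    simp

lemma integrable_cpow_vertical {c s : ℝ} (hc : 0 < c) (hs : 1 < s) :
    Integrable fun ξ : ℝ => (c + ξ * Complex.I : ℂ) ^ (-s : ℂ) := by
  have h0 : ∀ ξ : ℝ, (c + ξ * Complex.I : ℂ) ∈ Complex.slitPlane := fun ξ => Or.inl (by simpa)
  have hm : 0 < min c 1 / 2 := by positivity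
  have h1 := (integrable_one_add_norm (E := ℝ) (μ := volume) (r := s) (by simpa)).const_mul
    ((min c 1 / 2) ^ (-s))
  refine h1.mono' ?_ (ae_of_all _ fun ξ => ?_)
  · refine Continuous.aestronglyMeasurable (continuous_iff_continuousAt.2 fun ξ => ?_)
    exact ContinuousAt.cpow (by fun_prop) continuousAt_const (h0 ξ)
  · rw [← Complex.ofReal_neg, Complex.norm_cpow_real, ← Real.mul_rpow hm.le (by positivity)]
    refine Real.rpow_le_rpow_of_nonpos (by positivity) ?_ (by linarith)
    have h2 : c ≤ ‖(c + ξ * Complex.I : ℂ)‖ := by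
      simpa using Complex.re_le_norm (c + ξ * Complex.I : ℂ)
    have h3 : |ξ| ≤ ‖(c + ξ * Complex.I : ℂ)‖ := by
      simpa using Complex.abs_im_le_norm (c + ξ * Complex.I : ℂ)
    rw [Real.norm_eq_abs]
    nlinarith [min_le_left c 1, min_le_right c 1, abs_nonneg ξ, mul_nonneg
      (sub_nonneg.2 (min_le_right c 1)) (abs_nonneg ξ)]

/-- The inverse Laplace transform of `z ^ (-s)` along a vertical line. -/
lemma integral_exp_mul_cpow_vertical {c s y : ℝ} (hc : 0 < c) (hs : 1 < s) (hy : 0 < y) :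
    ∫ ξ : ℝ, Complex.exp (y * (c + ξ * Complex.I)) * (c + ξ * Complex.I : ℂ) ^ (-s : ℂ) =
      2 * Real.pi * ((y ^ (s - 1) / Real.Gamma s : ℝ) : ℂ) := by
  have hs0 : 0 < s := by linarith
  have hΓ := Real.Gamma_pos_of_pos hs0
  set g : ℝ → ℂ := (Set.Ioi 0).indicator fun x => ((x ^ (s - 1) * Real.exp (-(c * x)) : ℝ) : ℂ)
    with hg
  have hgi : Integrable g := by
    rw [hg, integrable_indicator_iff measurableSet_Ioi]
    have h := integrableOn_rpow_mul_exp_neg_mul_rpow (s := s - 1) (p := 1) (b := c)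
        (by linarith) one_pos hc
    simp only [Real.rpow_one, neg_mul] at h
    exact Integrable.ofReal h
  have hF : FourierTransform.fourier g = fun ξ : ℝ =>
      (c + ((2 * Real.pi * ξ : ℝ) : ℂ) * Complex.I : ℂ) ^ (-s : ℂ) * Real.Gamma s := by
    funext ξ
    rw [Real.fourier_real_eq_integral_exp_smul, ← integral_exp_mul_rpow hs0 (by simpa),
      ← integral_indicator measurableSet_Ioi]
    congr 1
    funext x
    rw [hg]
    by_cases hx : x ∈ Set.Ioi (0 : ℝ)
    · rw [Set.indicator_of_mem hx, Set.indicator_of_mem hx, smul_eq_mul]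
      push_cast
      rw [mul_left_comm, mul_comm, ← Complex.exp_add]
      congr 2
      ring
    · rw [Set.indicator_of_notMem hx, Set.indicator_of_notMem hx, smul_zero]
  have hFi : Integrable (FourierTransform.fourier g) := by
    rw [hF]
    exact ((integrable_cpow_vertical hc hs).comp_mul_left' (by positivity)).mul_const _
  have hcont : ContinuousAt g y := by
    have h1 : g =ᶠ[𝓝 y] fun x => ((x ^ (s - 1) * Real.exp (-(c * x)) : ℝ) : ℂ) := by
      filter_upwards [Ioi_mem_nhds hy] with x hx
      exact Set.indicator_of_mem hx _
    refine ContinuousAt.congr ?_ h1.symm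
    refine Complex.continuous_ofReal.continuousAt.comp (ContinuousAt.mul ?_ (by fun_prop))
    exact Real.continuousAt_rpow_const _ _ (Or.inl hy.ne')
  have hinv := hgi.fourierInv_fourier_eq hFi hcont
  rw [Real.fourierInv_eq', hF, hg, Set.indicator_of_mem (by exact hy)] at hinv
  have h2 := Measure.integral_comp_mul_left (fun ξ : ℝ => Complex.exp (ξ * y * Complex.I) *
    ((c + ξ * Complex.I : ℂ) ^ (-s : ℂ) * Real.Gamma s)) (2 * Real.pi)
  have h3 : ∫ ξ : ℝ, Complex.exp (ξ * y * Complex.I) *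
      ((c + ξ * Complex.I : ℂ) ^ (-s : ℂ) * Real.Gamma s) =
      2 * Real.pi * ((y ^ (s - 1) * Real.exp (-(c * y)) : ℝ) : ℂ) := by
    rw [← hinv]
    have h4 : ∀ v : ℝ, Complex.exp ((2 * Real.pi * inner ℝ v y : ℝ) * Complex.I) •
        ((c + ((2 * Real.pi * v : ℝ) : ℂ) * Complex.I : ℂ) ^ (-s : ℂ) * (Real.Gamma s : ℂ)) =
        Complex.exp (((2 * Real.pi * v : ℝ) : ℂ) * y * Complex.I) *
        ((c + ((2 * Real.pi * v : ℝ) : ℂ) * Complex.I : ℂ) ^ (-s : ℂ) * (Real.Gamma s : ℂ)) := by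
      intro v
      rw [smul_eq_mul]
      congr 2
      simp
      ring
    simp_rw [h4]
    have h5 : (2 * Real.pi : ℂ) * (((2 * Real.pi)⁻¹ : ℝ) : ℂ) = 1 := by
      rw [← Complex.ofReal_ofNat, ← Complex.ofReal_mul, ← Complex.ofReal_mul,
        mul_inv_cancel₀ (by positivity), Complex.ofReal_one]
    rw [h2, abs_of_pos (by positivity), Complex.real_smul, ← mul_assoc, h5, one_mul]
  have h5 : ∀ ξ : ℝ, Complex.exp (y * (c + ξ * Complex.I)) * (c + ξ * Complex.I : ℂ) ^ (-s : ℂ) =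
      (Complex.exp (c * y) / Real.Gamma s) * (Complex.exp (ξ * y * Complex.I) *
      ((c + ξ * Complex.I : ℂ) ^ (-s : ℂ) * Real.Gamma s)) := by
    intro ξ
    have : (Real.Gamma s : ℂ) ≠ 0 := by exact_mod_cast hΓ.ne'
    rw [mul_add, Complex.exp_add, mul_comm (c : ℂ) y, ← mul_assoc (y : ℂ), mul_comm (y : ℂ) ξ]
    field_simp
  simp_rw [h5]
  rw [integral_const_mul, h3]
  have : (Real.Gamma s : ℂ) ≠ 0 := by exact_mod_cast hΓ.ne'
  have h6 : Complex.exp (c * y) * Complex.exp (-(c * y)) = 1 := by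
    rw [← Complex.exp_add, add_neg_cancel, Complex.exp_zero]
  push_cast
  field_simp
  linear_combination ((y ^ (s - 1) : ℝ) : ℂ) * h6

/-- The integral of `f` along the counter-clockwise contour made of the half-lines `im z = -r` and
`im z = r` to the left of `re z = M` and of the vertical segment joining their end points. -/
def hankelInt (f : ℂ → ℂ) (M r : ℝ) : ℂ :=
  (∫ x in Set.Iic M, f (x + ((-r : ℝ) : ℂ) * Complex.I)) +
    Complex.I * (∫ s in (-r)..r, f (M + s * Complex.I)) -
    ∫ x in Set.Iic M, f (x + r * Complex.I)

/-- The plane cut along the half-line `(-∞, d]`. -/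
def slitAt (d : ℝ) : Set ℂ := {z | z - d ∈ Complex.slitPlane}

lemma isOpen_slitAt (d : ℝ) : IsOpen (slitAt d) :=
  Complex.isOpen_slitPlane.preimage (by fun_prop : Continuous fun z : ℂ => z - d)

lemma mem_slitAt_of_im_ne_zero {d : ℝ} {z : ℂ} (h : z.im ≠ 0) : z ∈ slitAt d :=
  Or.inr (by simpa using h)

lemma mem_slitAt_of_lt_re {d : ℝ} {z : ℂ} (h : d < z.re) : z ∈ slitAt d :=
  Or.inl (by simpa using h)

lemma slitAt_subset {c d : ℝ} (h : c ≤ d) : slitAt d ⊆ slitAt c := by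
  intro z hz
  rcases hz with hz | hz
  · exact mem_slitAt_of_lt_re (by simp at hz; linarith)
  · exact mem_slitAt_of_im_ne_zero (by simpa using hz)

/-- Regularity needed to integrate `exp (y * z) * Φ z` along a Hankel contour. -/
structure HankelRegular (Φ : ℂ → ℂ) (M r B : ℝ) : Prop where
  pos : 0 < r
  continuous_ray : ∀ c : ℝ, |c| = r → Continuous fun x : ℝ => Φ (x + c * Complex.I)
  continuous_vert : Continuous fun s : ℝ => Φ (M + s * Complex.I)
  bound : ∀ z : ℂ, |z.im| = r → ‖Φ z‖ ≤ B

lemma ContinuousOn.hankelRegular {Φ : ℂ → ℂ} {d M r B : ℝ} (hΦ : ContinuousOn Φ (slitAt d))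
    (hr : 0 < r) (hM : d < M) (hB : ∀ z : ℂ, |z.im| = r → ‖Φ z‖ ≤ B) : HankelRegular Φ M r B where
  pos := hr
  continuous_ray c hc := hΦ.comp_continuous (by fun_prop) fun x =>
    mem_slitAt_of_im_ne_zero (by simpa using abs_pos.1 (hc ▸ hr))
  continuous_vert := hΦ.comp_continuous (by fun_prop) fun x => mem_slitAt_of_lt_re (by simpa)
  bound := hB

namespace HankelRegular

variable {Φ Ψ : ℂ → ℂ} {M r B B' : ℝ} {y : ℂ}

lemma integrableOn_ray (h : HankelRegular Φ M r B) (hy : 0 < y.re) {c : ℝ} (hc : |c| = r) :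
    IntegrableOn (fun x : ℝ => Complex.exp (y * (x + c * Complex.I)) * Φ (x + c * Complex.I))
      (Set.Iic M) := by
  refine Integrable.mono' ((integrableOn_exp_mul_Iic hy M).const_mul
    (Real.exp (-(y.im * c)) * B)) ?_ (ae_of_all _ fun x => ?_)
  · exact ((by fun_prop : Continuous fun x : ℝ => Complex.exp (y * (x + c * Complex.I))).mul
      (h.continuous_ray c hc)).aestronglyMeasurable
  · rw [norm_mul, Complex.norm_exp]
    have h1 : (y * (x + c * Complex.I)).re = -(y.im * c) + y.re * x := by simp; ring
    rw [h1, Real.exp_add, mul_right_comm]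
    gcongr
    exact h.bound _ (by simpa using hc)

lemma intervalIntegrable_vert (h : HankelRegular Φ M r B) (y : ℂ) (a b : ℝ) :
    IntervalIntegrable (fun s : ℝ => Complex.exp (y * (M + s * Complex.I)) *
      Φ (M + s * Complex.I)) volume a b := by
  exact ((by fun_prop : Continuous fun s : ℝ => Complex.exp (y * (M + s * Complex.I))).mul
    h.continuous_vert).intervalIntegrable a b

lemma abs_neg_eq (h : HankelRegular Φ M r B) : |-r| = r := by
  rw [abs_neg, abs_of_pos h.pos]

lemma abs_eq (h : HankelRegular Φ M r B) : |r| = r := abs_of_pos h.pos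

lemma hankelInt_add (hΦ : HankelRegular Φ M r B) (hΨ : HankelRegular Ψ M r B') (hy : 0 < y.re)
    (u v : ℂ) : hankelInt (fun z => Complex.exp (y * z) * (u * Φ z + v * Ψ z)) M r =
      u * hankelInt (fun z => Complex.exp (y * z) * Φ z) M r +
        v * hankelInt (fun z => Complex.exp (y * z) * Ψ z) M r := by
  have e : ∀ z, Complex.exp (y * z) * (u * Φ z + v * Ψ z) =
      u * (Complex.exp (y * z) * Φ z) + v * (Complex.exp (y * z) * Ψ z) := fun z => by ring
  simp only [hankelInt, e]
  rw [integral_add ((hΦ.integrableOn_ray hy hΦ.abs_neg_eq).const_mul u)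
      ((hΨ.integrableOn_ray hy hΦ.abs_neg_eq).const_mul v),
    integral_add ((hΦ.integrableOn_ray hy hΦ.abs_eq).const_mul u)
      ((hΨ.integrableOn_ray hy hΦ.abs_eq).const_mul v),
    intervalIntegral.integral_add ((hΦ.intervalIntegrable_vert y _ _).const_mul u)
      ((hΨ.intervalIntegrable_vert y _ _).const_mul v)]
  simp only [integral_const_mul, intervalIntegral.integral_const_mul]
  ring

lemma differentiableAt_ray (h : HankelRegular Φ M r B) (hy : 0 < y.re) {c : ℝ} (hc : |c| = r) :
    DifferentiableAt ℂ (fun w => ∫ x in Set.Iic M, Complex.exp (w * (x + c * Complex.I)) *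
      Φ (x + c * Complex.I)) y := by
  have hΦ := h.continuous_ray c hc
  refine differentiableAt_integral_exp_mul (δ := y.re / 2)
    (by fun_prop : Continuous fun x : ℝ => (x + c * Complex.I : ℂ)).aestronglyMeasurable
    hΦ.aestronglyMeasurable (by positivity) ?_
  have hhalf : 0 < y.re / 2 := by positivity
  refine Integrable.mono' ((integrableOn_exp_mul_Iic hhalf M).const_mul
    (Real.exp (-(y.im * c) + y.re * (|M| + r)) * B)) ?_ ?_
  · exact ((by fun_prop : Continuous fun x : ℝ => Real.exp ((y * (x + c * Complex.I)).re +
      y.re / 2 * ‖(x + c * Complex.I : ℂ)‖)).mul hΦ.norm).aestronglyMeasurable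
  · refine (ae_restrict_iff' measurableSet_Iic).2 (ae_of_all _ fun x hx => ?_)
    have hx' : x ≤ M := hx
    have h0 := h.pos
    have h1 : ‖(x + c * Complex.I : ℂ)‖ ≤ |x| + r := by
      refine (norm_add_le _ _).trans ?_
      simp [hc]
    have h2 : |x| ≤ -x + 2 * |M| := by
      rcases abs_cases x with hh | hh <;> nlinarith [le_abs_self M, abs_nonneg M]
    rw [norm_mul, norm_norm, Real.norm_of_nonneg (Real.exp_nonneg _), mul_right_comm,
      ← Real.exp_add]
    refine mul_le_mul (Real.exp_le_exp.2 ?_) (h.bound _ (by simpa using hc)) (norm_nonneg _)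
      (Real.exp_nonneg _)
    have h3 : (y * (x + c * Complex.I)).re = -(y.im * c) + y.re * x := by simp; ring
    rw [h3]
    nlinarith [mul_le_mul_of_nonneg_left h1 hy.le, mul_le_mul_of_nonneg_left h2 hy.le, mul_pos hy h0]

lemma differentiableAt_hankelInt (h : HankelRegular Φ M r B) (hy : 0 < y.re) :
    DifferentiableAt ℂ (fun w => hankelInt (fun z => Complex.exp (w * z) * Φ z) M r) y := by
  refine ((h.differentiableAt_ray hy h.abs_neg_eq).add (DifferentiableAt.const_mul ?_ _)).sub
    (h.differentiableAt_ray hy h.abs_eq)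
  have h0 := h.pos
  have hΦ := h.continuous_vert
  simp only [intervalIntegral.integral_of_le (by linarith : -r ≤ r)]
  refine differentiableAt_integral_exp_mul (δ := 1)
    (by fun_prop : Continuous fun s : ℝ => (M + s * Complex.I : ℂ)).aestronglyMeasurable
    hΦ.aestronglyMeasurable one_pos ?_
  exact ((by fun_prop : Continuous fun s : ℝ => Real.exp ((y * (M + s * Complex.I)).re +
      1 * ‖(M + s * Complex.I : ℂ)‖)).mul hΦ.norm).integrableOn_Ioc

/-- The contour integral of a derivative vanishes. -/
lemma hankelInt_deriv (h : HankelRegular Φ M r B) (h' : HankelRegular Ψ M r B') (hy : 0 < y.re)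
    (hd : ∀ z : ℂ, M ≤ z.re ∨ |z.im| = r →
      HasDerivAt (fun z => Complex.exp (y * z) * Φ z) (Complex.exp (y * z) * Ψ z) z) :
    hankelInt (fun z => Complex.exp (y * z) * Ψ z) M r = 0 := by
  have hray : ∀ c : ℝ, |c| = r → ∫ x in Set.Iic M, Complex.exp (y * (x + c * Complex.I)) *
      Ψ (x + c * Complex.I) = Complex.exp (y * (M + c * Complex.I)) * Φ (M + c * Complex.I) := by
    intro c hc
    have h1 : ∀ x : ℝ, HasDerivAt (fun x : ℝ => Complex.exp (y * (x + c * Complex.I)) *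
        Φ (x + c * Complex.I)) (Complex.exp (y * (x + c * Complex.I)) *
        Ψ (x + c * Complex.I)) x := by
      intro x
      have h2 : HasDerivAt (fun x : ℝ => (x + c * Complex.I : ℂ)) 1 x :=
        ((hasDerivAt_id x).ofReal_comp).add_const _
      have h3 := (hd (x + c * Complex.I) (Or.inr (by simpa using hc))).comp x h2
      rw [mul_one] at h3
      exact h3
    have h2 : Tendsto (fun x : ℝ => Complex.exp (y * (x + c * Complex.I)) *
        Φ (x + c * Complex.I)) atBot (𝓝 0) := by
      have h3 : Tendsto (fun x : ℝ => Real.exp (-(y.im * c) + y.re * x) * B) atBot (𝓝 0) := by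
        rw [← zero_mul B]
        refine (Real.tendsto_exp_atBot.comp ?_).mul_const B
        exact tendsto_atBot_add_const_left _ _ (tendsto_id.const_mul_atBot hy)
      refine squeeze_zero_norm (fun x => ?_) h3
      rw [norm_mul, Complex.norm_exp]
      have h1 : (y * (x + c * Complex.I)).re = -(y.im * c) + y.re * x := by simp; ring
      rw [h1]
      gcongr
      exact h.bound _ (by simpa using hc)
    rw [integral_Iic_of_hasDerivAt_of_tendsto' (fun x _ => h1 x) (h'.integrableOn_ray hy hc) h2,
      sub_zero]
  have hvert : Complex.I * ∫ s in (-r)..r, Complex.exp (y * (M + s * Complex.I)) *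
      Ψ (M + s * Complex.I) = Complex.exp (y * (M + r * Complex.I)) * Φ (M + r * Complex.I) -
      Complex.exp (y * (M + ((-r : ℝ) : ℂ) * Complex.I)) * Φ (M + ((-r : ℝ) : ℂ) * Complex.I) := by
    rw [← intervalIntegral.integral_const_mul]
    refine intervalIntegral.integral_eq_sub_of_hasDerivAt (f := fun s : ℝ =>
      Complex.exp (y * (M + s * Complex.I)) * Φ (M + s * Complex.I)) (fun s _ => ?_)
      ((h'.intervalIntegrable_vert y _ _).const_mul _)
    have h2 : HasDerivAt (fun s : ℝ => (M + s * Complex.I : ℂ)) Complex.I s := by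
      simpa using (((hasDerivAt_id s).ofReal_comp).mul_const Complex.I).const_add (M : ℂ)
    have := (hd (M + s * Complex.I) (Or.inl (by simp))).comp s h2
    rw [mul_comm] at this
    exact this
  rw [hankelInt, hray _ h.abs_neg_eq, hray _ h.abs_eq, hvert]
  ring

end HankelRegular

lemma norm_sub_cpow_le {s t ρ : ℝ} {z : ℂ} (hs : 0 < s) (hρ : 0 < ρ) (hz : ρ ≤ |z.im|) :
    ‖(z - t : ℂ) ^ (-s : ℂ)‖ ≤ ρ ^ (-s) := by
  rw [← Complex.ofReal_neg, Complex.norm_cpow_real]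
  refine Real.rpow_le_rpow_of_nonpos hρ (hz.trans ?_) (by linarith)
  simpa using Complex.abs_im_le_norm (z - t)

lemma hasDerivAt_sub_cpow (s : ℝ) {t : ℝ} {z : ℂ} (hz : z ∈ slitAt t) :
    HasDerivAt (fun z : ℂ => (z - t) ^ (-s : ℂ)) (-s * (z - t) ^ (-(s + 1 : ℝ) : ℂ)) z := by
  have h := ((hasDerivAt_id z).sub_const (t : ℂ)).cpow_const (c := (-s : ℂ)) hz
  simp only [id, mul_one] at h
  convert h using 3
  push_cast
  ring

lemma hankelRegular_sub_cpow {s t M r : ℝ} (hs : 0 < s) (ht : t < M) (hr : 0 < r) :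
    HankelRegular (fun z => (z - t : ℂ) ^ (-s : ℂ)) M r (r ^ (-s)) :=
  ContinuousOn.hankelRegular
    (fun _ hz => (hasDerivAt_sub_cpow s hz).continuousAt.continuousWithinAt) hr ht
    fun _ hz => norm_sub_cpow_le hs hr hz.ge

lemma hankelInt_sub_cpow_eq_of_le {s t M r R y : ℝ} (hs : 0 < s) (ht : t < M) (hr : 0 < r)
    (hR : r ≤ R) (hy : 0 < y) :
    hankelInt (fun z => Complex.exp (y * z) * (z - t : ℂ) ^ (-s : ℂ)) M R =
      hankelInt (fun z => Complex.exp (y * z) * (z - t : ℂ) ^ (-s : ℂ)) M r := by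
  set f : ℂ → ℂ := fun z => Complex.exp (y * z) * (z - t : ℂ) ^ (-s : ℂ) with hf
  have hd : ∀ z : ℂ, z.im ≠ 0 → DifferentiableAt ℂ f z := fun z hz =>
    (by fun_prop : DifferentiableAt ℂ (fun z : ℂ => Complex.exp (y * z)) z).mul
      (hasDerivAt_sub_cpow s (mem_slitAt_of_im_ne_zero hz)).differentiableAt
  have hb : ∀ z : ℂ, r ≤ |z.im| → ‖f z‖ ≤ r ^ (-s) * Real.exp (y * z.re) := fun z hz => by
    rw [hf, norm_mul, Complex.norm_exp, mul_comm]
    have h1 : (y * z).re = y * z.re := by simp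
    rw [h1]
    gcongr
    exact norm_sub_cpow_le hs hr hz
  have h1 := integral_halfStrip_boundary (f := f) (M := M) hy hR
    (fun z _ hz => hd z (by linarith [hz.1] : 0 < z.im).ne')
    (fun z _ hz => hb z (hz.1.trans (le_abs_self _)))
  have h2 := integral_halfStrip_boundary (f := f) (M := M) hy (neg_le_neg hR)
    (fun z _ hz => hd z (by linarith [hz.2] : z.im < 0).ne)
    (fun z _ hz => hb z ((by linarith [hz.2] : r ≤ -z.im).trans (neg_le_abs _)))
  have hi := (hankelRegular_sub_cpow hs ht hr).intervalIntegrable_vert (y : ℂ)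
  have h3 : (∫ u in (-R)..R, f (M + u * Complex.I)) = (∫ u in (-R)..(-r), f (M + u * Complex.I)) +
      (∫ u in (-r)..r, f (M + u * Complex.I)) + ∫ u in r..R, f (M + u * Complex.I) := by
    rw [intervalIntegral.integral_add_adjacent_intervals (hi _ _) (hi _ _),
      intervalIntegral.integral_add_adjacent_intervals (hi _ _) (hi _ _)]
  rw [hankelInt, hankelInt, h3]
  linear_combination h1 + h2

/-- Hankel's formula for a real parameter and an exponent larger than one. -/
lemma hankelInt_sub_cpow_of_one_lt {s t M r y : ℝ} (hs : 1 < s) (ht : t < M) (hr : 0 < r)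
    (hy : 0 < y) :
    hankelInt (fun z => Complex.exp (y * z) * (z - t : ℂ) ^ (-s : ℂ)) M r =
      2 * Real.pi * Complex.I * ((y ^ (s - 1) / Real.Gamma s : ℝ) : ℂ) * Complex.exp (y * t) := by
  have hs0 : 0 < s := by linarith
  set f : ℂ → ℂ := fun z => Complex.exp (y * z) * (z - t : ℂ) ^ (-s : ℂ) with hf
  have hray : ∀ c : ℝ, |c| = 1 →
      Tendsto (fun R : ℝ => ∫ x in Set.Iic M, f (x + (c * R : ℝ) * Complex.I)) atTop (𝓝 0) := by
    intro c hc
    have h1 : Tendsto (fun R : ℝ => R ^ (-s) * ∫ x in Set.Iic M, Real.exp (y * x)) atTop (𝓝 0) := by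
      simpa using (tendsto_rpow_neg_atTop hs0).mul_const (∫ x in Set.Iic M, Real.exp (y * x))
    refine squeeze_zero_norm' ?_ h1
    filter_upwards [eventually_gt_atTop 0] with R hR
    rw [← integral_const_mul]
    refine norm_integral_le_of_norm_le ((integrableOn_exp_mul_Iic hy M).const_mul _)
      (ae_of_all _ fun x => ?_)
    have h2 : (y * (x + (c * R : ℝ) * Complex.I) : ℂ).re = y * x := by simp
    rw [hf, norm_mul, Complex.norm_exp, mul_comm, h2]
    gcongr
    exact norm_sub_cpow_le hs0 hR (by simp [abs_mul, hc, abs_of_pos hR])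
  have hcv : ∀ ξ : ℝ, f (M + ξ * Complex.I) = Complex.exp (y * t) *
      (Complex.exp (y * ((M - t : ℝ) + ξ * Complex.I)) *
        ((M - t : ℝ) + ξ * Complex.I : ℂ) ^ (-s : ℂ)) := by
    intro ξ
    rw [← mul_assoc, ← Complex.exp_add, hf]
    push_cast
    ring_nf
  have hvi : Integrable fun ξ : ℝ => f (M + ξ * Complex.I) := by
    simp only [hcv]
    refine Integrable.const_mul ?_ _
    have h1 := (integrable_cpow_vertical (sub_pos.2 ht) hs).norm.const_mul
      (Real.exp (y * (M - t)))
    refine h1.mono' ?_ (ae_of_all _ fun ξ => ?_)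
    · exact (by fun_prop : Continuous fun ξ : ℝ => Complex.exp
        (y * ((M - t : ℝ) + ξ * Complex.I))).aestronglyMeasurable.mul
        (integrable_cpow_vertical (sub_pos.2 ht) hs).aestronglyMeasurable
    · rw [norm_mul, Complex.norm_exp]
      simp
  have hv := intervalIntegral_tendsto_integral hvi tendsto_neg_atTop_atBot tendsto_id
  have hlim : Tendsto (fun R : ℝ => hankelInt f M R) atTop
      (𝓝 (0 + Complex.I * (∫ ξ : ℝ, f (M + ξ * Complex.I)) - 0)) := by
    have h1 := ((hray (-1) (by simp)).add (hv.const_mul Complex.I)).sub (hray 1 (by simp))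
    simp only [neg_one_mul, one_mul] at h1
    exact h1
  have heq : hankelInt f M r = 0 + Complex.I * (∫ ξ : ℝ, f (M + ξ * Complex.I)) - 0 := by
    refine tendsto_nhds_unique (tendsto_const_nhds.congr' ?_) hlim
    filter_upwards [eventually_ge_atTop r] with R hR
    exact (hankelInt_sub_cpow_eq_of_le hs0 ht hr hR hy).symm
  rw [heq]
  simp only [hcv]
  rw [integral_const_mul, integral_exp_mul_cpow_vertical (sub_pos.2 ht) hs hy]
  ring

/-- Hankel's formula. -/
lemma hankelInt_sub_cpow {s t M r : ℝ} (hs : 0 < s) (ht : t < M) (hr : 0 < r) {y : ℂ}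
    (hy : 0 < y.re) :
    hankelInt (fun z => Complex.exp (y * z) * (z - t : ℂ) ^ (-s : ℂ)) M r =
      2 * Real.pi * Complex.I * (y ^ ((s - 1 : ℝ) : ℂ) / Real.Gamma s) * Complex.exp (y * t) := by
  have hΓ : (Real.Gamma s : ℂ) ≠ 0 := by exact_mod_cast (Real.Gamma_pos_of_pos hs).ne'
  refine eq_of_eq_ofReal_of_re_pos
    (f := fun y => hankelInt (fun z => Complex.exp (y * z) * (z - t : ℂ) ^ (-s : ℂ)) M r)
    (g := fun y => 2 * Real.pi * Complex.I * (y ^ ((s - 1 : ℝ) : ℂ) / Real.Gamma s) *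
      Complex.exp (y * t))
    (fun w hw => (hankelRegular_sub_cpow hs ht hr).differentiableAt_hankelInt hw)
    (fun w hw => ?_) (fun x hx => ?_) hy
  · have h1 : DifferentiableAt ℂ (fun w : ℂ => w ^ ((s - 1 : ℝ) : ℂ)) w :=
      differentiableAt_id.cpow_const (mem_slitPlane_of_re_pos hw)
    fun_prop
  · have hreg := hankelRegular_sub_cpow hs ht hr
    have hreg' := hankelRegular_sub_cpow (by linarith : 0 < s + 1) ht hr
    have hx' : (0 : ℝ) < (x : ℂ).re := by simpa
    have hx0 : (x : ℂ) ≠ 0 := by exact_mod_cast hx.ne'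
    have hs0 : (s : ℂ) ≠ 0 := by exact_mod_cast hs.ne'
    have hadd := hreg.hankelInt_add hreg' hx' x (-s)
    have hbd : ∀ z : ℂ, |z.im| = r →
        ‖(x * (z - t : ℂ) ^ (-s : ℂ) + -s * (z - t : ℂ) ^ (-(s + 1 : ℝ) : ℂ) : ℂ)‖ ≤
          x * r ^ (-s) + s * r ^ (-(s + 1)) := by
      intro z hz
      refine (norm_add_le _ _).trans ?_
      rw [norm_mul, norm_mul, norm_neg, Complex.norm_real, Complex.norm_real,
        Real.norm_of_nonneg hx.le, Real.norm_of_nonneg hs.le]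
      gcongr
      · exact hreg.bound z hz
      · exact hreg'.bound z hz
    have hzero := hreg.hankelInt_deriv (y := x)
      (Ψ := fun z => x * (z - t : ℂ) ^ (-s : ℂ) + -s * (z - t : ℂ) ^ (-(s + 1 : ℝ) : ℂ))
      (ContinuousOn.hankelRegular (d := t) (fun z hz => ContinuousAt.continuousWithinAt
        (((hasDerivAt_sub_cpow s hz).continuousAt.const_mul (x : ℂ)).add
        ((hasDerivAt_sub_cpow (s + 1) hz).continuousAt.const_mul (-s : ℂ)))) hr ht hbd) hx' ?_
    · rw [hzero, hankelInt_sub_cpow_of_one_lt (s := s + 1) (by linarith) ht hr hx, Real.Gamma_add_one hs.ne',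
        add_sub_cancel_right] at hadd
      have h1 : (x : ℂ) ^ ((s - 1 : ℝ) : ℂ) * x = ((x ^ s : ℝ) : ℂ) := by
        rw [← Complex.ofReal_cpow hx.le, ← Complex.ofReal_mul, Real.rpow_sub_one hx.ne',
          div_mul_cancel₀ _ hx.ne']
      refine mul_left_cancel₀ hx0 ?_
      have h2 : (x : ℂ) * hankelInt (fun z => Complex.exp (x * z) * (z - t : ℂ) ^ (-s : ℂ)) M r =
          s * (2 * Real.pi * Complex.I * ((x ^ s / (s * Real.Gamma s) : ℝ) : ℂ) *
            Complex.exp (x * t)) := by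
        linear_combination -hadd
      rw [h2]
      push_cast [← h1]
      field_simp
    · intro z hz
      have hzs : z ∈ slitAt t := by
        rcases hz with hz | hz
        · exact mem_slitAt_of_lt_re (ht.trans_le hz)
        · exact mem_slitAt_of_im_ne_zero (abs_pos.1 (hz ▸ hr))
      have h1 : HasDerivAt (fun z : ℂ => Complex.exp (x * z)) (Complex.exp (x * z) * x) z := by
        simpa using ((hasDerivAt_id z).const_mul (x : ℂ)).cexp
      refine (h1.mul (hasDerivAt_sub_cpow s hzs)).congr_deriv ?_
      ring

lemma isPreconnected_slitAt (d : ℝ) : IsPreconnected (slitAt d) := by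
  have h1 : slitAt d = (fun z : ℂ => z + d) '' Complex.slitPlane := by
    ext z
    constructor
    · intro hz
      exact ⟨z - d, hz, by simp⟩
    · rintro ⟨w, hw, rfl⟩
      simpa [slitAt] using hw
  rw [h1]
  refine IsPreconnected.image ?_ _ (by fun_prop)
  exact (Complex.starConvex_one_slitPlane.isPathConnected
    Complex.one_mem_slitPlane).isConnected.isPreconnected

lemma ofReal_notMem_slitAt {t d : ℝ} (h : t ≤ d) : (t : ℂ) ∉ slitAt d := by
  simp [slitAt, Complex.mem_slitPlane_iff, h]

section Stieltjes

variable {μ ν : Measure ℝ} {s d M r : ℝ}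

lemma differentiableOn_integral_sub_cpow [IsFiniteMeasure μ] (hμ : ∀ᵐ t ∂μ, t ≤ d) (hs : 0 < s) :
    DifferentiableOn ℂ (fun z : ℂ => ∫ t, (z - (t : ℝ)) ^ (-s : ℂ) ∂μ) (slitAt d) := by
  intro z hz
  obtain ⟨ε, hε, hball⟩ := Metric.isOpen_iff.1 (isOpen_slitAt d) z hz
  have hdist : ∀ w ∈ Metric.ball z (ε / 2), ∀ t ≤ d, ε / 2 ≤ ‖w - (t : ℝ)‖ := by
    intro w hw t ht
    by_contra! hlt
    refine ofReal_notMem_slitAt ht (hball ?_)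
    rw [mem_ball_iff_norm] at hw ⊢
    calc ‖(t : ℂ) - z‖ = ‖(w - z) - (w - t)‖ := by ring_nf
      _ ≤ ‖w - z‖ + ‖w - t‖ := norm_sub_le _ _
      _ < ε := by linarith
  have hnorm : ∀ p : ℝ, 0 < p → ∀ w ∈ Metric.ball z (ε / 2), ∀ t ≤ d,
      ‖(w - (t : ℝ)) ^ (-p : ℂ)‖ ≤ (ε / 2) ^ (-p) := by
    intro p hp w hw t ht
    rw [← Complex.ofReal_neg, Complex.norm_cpow_real]
    exact Real.rpow_le_rpow_of_nonpos (by positivity) (hdist w hw t ht) (by linarith)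
  have hmeas : ∀ (p : ℝ) (w : ℂ), AEStronglyMeasurable (fun t : ℝ => (w - (t : ℂ)) ^ (-p : ℂ)) μ :=
    fun p w => (by fun_prop : Measurable fun t : ℝ => (w - (t : ℂ)) ^ (-p : ℂ)).aestronglyMeasurable
  refine ((hasDerivAt_integral_of_dominated_loc_of_deriv_le (𝕜 := ℂ)
    (F' := fun w t => -s * (w - (t : ℝ)) ^ (-(s + 1 : ℝ) : ℂ))
    (bound := fun _ => s * (ε / 2) ^ (-(s + 1)))
    (Metric.ball_mem_nhds z (half_pos hε)) (Eventually.of_forall fun w => hmeas s w) ?_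
    ((hmeas (s + 1) z).const_mul _) ?_ (integrable_const _)
    ?_).2.differentiableAt).differentiableWithinAt
  · refine (integrable_const ((ε / 2) ^ (-s))).mono' (hmeas s z) ?_
    filter_upwards [hμ] with t ht using hnorm s hs z (Metric.mem_ball_self (by positivity)) t ht
  · filter_upwards [hμ] with t ht w hw
    rw [norm_mul, norm_neg, Complex.norm_real, Real.norm_of_nonneg hs.le]
    gcongr
    exact hnorm (s + 1) (by linarith) w hw t ht
  · filter_upwards [hμ] with t ht w hw
    refine hasDerivAt_sub_cpow s (slitAt_subset ht (hball ?_))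
    exact Metric.ball_subset_ball (by linarith) hw

lemma integral_sub_cpow_ofReal (hμ : ∀ᵐ t ∂μ, t ≤ d) {x : ℝ} (hx : d < x) :
    ∫ t, ((x : ℂ) - (t : ℝ)) ^ (-s : ℂ) ∂μ = ((∫ t, (x - t) ^ (-s) ∂μ : ℝ) : ℂ) := by
  rw [← integral_complex_ofReal]
  refine integral_congr_ae ?_
  filter_upwards [hμ] with t ht
  rw [Complex.ofReal_cpow (by linarith)]
  simp

/-- A holomorphic function which agrees with a generalized Stieltjes transform on a real half-line
agrees with it on the cut plane. -/
lemma eq_integral_sub_cpow [IsFiniteMeasure μ] (hμ : ∀ᵐ t ∂μ, t ≤ d) (hs : 0 < s) {Φ : ℂ → ℂ}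
    (hΦ : DifferentiableOn ℂ Φ (slitAt d))
    (h : ∀ x : ℝ, d < x → Φ x = ((∫ t, (x - t) ^ (-s) ∂μ : ℝ) : ℂ)) {z : ℂ} (hz : z ∈ slitAt d) :
    Φ z = ∫ t, (z - (t : ℝ)) ^ (-s : ℂ) ∂μ := by
  refine eqOn_of_eq_ofReal (isOpen_slitAt d) (isPreconnected_slitAt d) hΦ
    (differentiableOn_integral_sub_cpow hμ hs) (x₀ := d + 1)
    (mem_slitAt_of_lt_re (by simp)) (fun x hx => ?_) hz
  rw [h x (by linarith), integral_sub_cpow_ofReal hμ (by linarith)]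

/-- The Laplace transform of a measure as a contour integral of its Stieltjes transform. -/
lemma hankelInt_integral_sub_cpow [IsFiniteMeasure μ] (hμ : ∀ᵐ t ∂μ, t ≤ d) (hs : 0 < s)
    (hM : d < M) (hr : 0 < r) {y : ℂ} (hy : 0 < y.re) :
    hankelInt (fun z => Complex.exp (y * z) * ∫ t, (z - (t : ℝ)) ^ (-s : ℂ) ∂μ) M r =
      2 * Real.pi * Complex.I * (y ^ ((s - 1 : ℝ) : ℂ) / Real.Gamma s) *
        ∫ t, Complex.exp (y * (t : ℝ)) ∂μ := by
  set k : ℂ → ℝ → ℂ := fun z t => Complex.exp (y * z) * (z - t) ^ (-s : ℂ) with hk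
  have hray : ∀ c : ℝ, |c| = r → Integrable (fun p : ℝ × ℝ => k (p.1 + c * Complex.I) p.2)
      ((volume.restrict (Set.Iic M)).prod μ) := by
    intro c hc
    refine (((integrableOn_exp_mul_Iic hy M).const_mul
      (Real.exp (-(y.im * c)) * r ^ (-s))).comp_fst μ).mono' ?_ (ae_of_all _ fun p => ?_)
    · exact (by fun_prop : Measurable fun p : ℝ × ℝ => Complex.exp (y * (p.1 + c * Complex.I)) *
        (p.1 + c * Complex.I - p.2) ^ (-s : ℂ)).aestronglyMeasurable
    · have h1 : (y * (p.1 + c * Complex.I)).re = -(y.im * c) + y.re * p.1 := by simp; ring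
      rw [hk, norm_mul, Complex.norm_exp, h1, Real.exp_add, mul_right_comm]
      gcongr
      exact norm_sub_cpow_le hs hr (by simp [hc])
  have hvert : Integrable (fun p : ℝ × ℝ => k (M + p.1 * Complex.I) p.2)
      ((volume.restrict (Set.Ioc (-r) r)).prod μ) := by
    have h0 : IntegrableOn (fun u : ℝ => Real.exp (y * (M + u * Complex.I)).re * (M - d) ^ (-s))
        (Set.Ioc (-r) r) := (by fun_prop : Continuous fun u : ℝ =>
      Real.exp (y * (M + u * Complex.I)).re * (M - d) ^ (-s)).integrableOn_Ioc
    refine (Integrable.comp_fst h0 μ).mono' ?_ ?_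
    · exact (by fun_prop : Measurable fun p : ℝ × ℝ => Complex.exp (y * (M + p.1 * Complex.I)) *
        (M + p.1 * Complex.I - p.2) ^ (-s : ℂ)).aestronglyMeasurable
    · filter_upwards [Measure.quasiMeasurePreserving_snd.ae hμ] with p hp
      rw [hk, norm_mul, Complex.norm_exp]
      gcongr
      rw [← Complex.ofReal_neg, Complex.norm_cpow_real]
      refine Real.rpow_le_rpow_of_nonpos (by linarith) ?_ (by linarith)
      refine le_trans ?_ (Complex.re_le_norm _)
      have hp' : p.2 ≤ d := hp
      simp
      linarith
  have e : ∀ z : ℂ, Complex.exp (y * z) * ∫ t, (z - (t : ℝ)) ^ (-s : ℂ) ∂μ = ∫ t, k z t ∂μ :=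
    fun z => (integral_const_mul _ _).symm
  have hle : -r ≤ r := by linarith
  have hneg : |-r| = r := by rw [abs_neg, abs_of_pos hr]
  have hpos : |r| = r := abs_of_pos hr
  simp only [e]
  have hswap : ∀ c : ℝ, |c| = r → ∫ x in Set.Iic M, ∫ t, k (x + c * Complex.I) t ∂μ =
      ∫ t, (∫ x in Set.Iic M, k (x + c * Complex.I) t) ∂μ := fun c hc =>
    integral_integral_swap (hray c hc)
  have hswap' : ∫ u in Set.Ioc (-r) r, ∫ t, k (M + u * Complex.I) t ∂μ =
      ∫ t, (∫ u in Set.Ioc (-r) r, k (M + u * Complex.I) t) ∂μ := integral_integral_swap hvert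
  have hlow : Integrable (fun t => ∫ x in Set.Iic M, k (x + ((-r : ℝ) : ℂ) * Complex.I) t) μ :=
    (hray _ hneg).integral_prod_right
  have hup : Integrable (fun t => ∫ x in Set.Iic M, k (x + r * Complex.I) t) μ :=
    (hray _ hpos).integral_prod_right
  have hmid : Integrable (fun t => Complex.I * ∫ u in Set.Ioc (-r) r, k (M + u * Complex.I) t) μ :=
    hvert.integral_prod_right.const_mul _
  have hsum : Integrable (fun t => (∫ x in Set.Iic M, k (x + ((-r : ℝ) : ℂ) * Complex.I) t) +
      Complex.I * ∫ u in Set.Ioc (-r) r, k (M + u * Complex.I) t) μ := hlow.add hmid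
  rw [hankelInt, intervalIntegral.integral_of_le hle, hswap _ hneg, hswap _ hpos, hswap',
    ← integral_const_mul, ← integral_add hlow hmid, ← integral_sub hsum hup, ← integral_const_mul]
  refine integral_congr_ae ?_
  filter_upwards [hμ] with t ht
  rw [← hankelInt_sub_cpow hs (ht.trans_lt hM) hr hy, hankelInt,
    intervalIntegral.integral_of_le hle]

lemma integral_exp_eq_hankelInt [IsFiniteMeasure μ] (hμ : ∀ᵐ t ∂μ, t ≤ d) (hs : 0 < s)
    (hM : d < M) (hr : 0 < r) {y : ℂ} (hy : 0 < y.re) {Φ : ℂ → ℂ}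
    (hΦ : DifferentiableOn ℂ Φ (slitAt d))
    (h : ∀ x : ℝ, d < x → Φ x = ((∫ t, (x - t) ^ (-s) ∂μ : ℝ) : ℂ)) :
    ∫ t, Complex.exp (y * (t : ℝ)) ∂μ = (Real.Gamma s / y ^ ((s - 1 : ℝ) : ℂ)) *
      (2 * Real.pi * Complex.I)⁻¹ * hankelInt (fun z => Complex.exp (y * z) * Φ z) M r := by
  have h1 : hankelInt (fun z => Complex.exp (y * z) * Φ z) M r =
      hankelInt (fun z => Complex.exp (y * z) * ∫ t, (z - (t : ℝ)) ^ (-s : ℂ) ∂μ) M r := by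
    have e : ∀ z ∈ slitAt d, Complex.exp (y * z) * Φ z =
        Complex.exp (y * z) * ∫ t, (z - (t : ℝ)) ^ (-s : ℂ) ∂μ := fun z hz => by
      rw [eq_integral_sub_cpow hμ hs hΦ h hz]
    have e1 : ∀ c : ℝ, c ≠ 0 → ∀ x : ℝ, (x + c * Complex.I : ℂ) ∈ slitAt d := fun c hc x =>
      mem_slitAt_of_im_ne_zero (by simpa)
    have e2 : ∀ x : ℝ, (M + x * Complex.I : ℂ) ∈ slitAt d := fun x =>
      mem_slitAt_of_lt_re (by simpa)
    simp only [hankelInt, e _ (e1 _ (neg_ne_zero.2 hr.ne') _), e _ (e1 _ hr.ne' _), e _ (e2 _)]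
  rw [h1, hankelInt_integral_sub_cpow hμ hs hM hr hy]
  have hΓ : (Real.Gamma s : ℂ) ≠ 0 := by exact_mod_cast (Real.Gamma_pos_of_pos hs).ne'
  have hy0 : y ^ ((s - 1 : ℝ) : ℂ) ≠ 0 := by
    have hy' : y ≠ 0 := fun h => by simp [h] at hy
    rw [Complex.cpow_def_of_ne_zero hy']
    exact Complex.exp_ne_zero _
  have hpi : (Real.pi : ℂ) ≠ 0 := by exact_mod_cast Real.pi_ne_zero
  field_simp

/-- A measure bounded above is determined by its Laplace transform. -/
lemma MeasureTheory.Measure.ext_of_integral_exp [IsFiniteMeasure μ] [IsFiniteMeasure ν] (hμ : ∀ᵐ t ∂μ, t ≤ d)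
    (hν : ∀ᵐ t ∂ν, t ≤ d) (h : ∀ y : ℂ, 0 < y.re →
      ∫ t, Complex.exp (y * (t : ℝ)) ∂μ = ∫ t, Complex.exp (y * (t : ℝ)) ∂ν) : μ = ν := by
  set e : ℝ → ℝ≥0∞ := fun t => ENNReal.ofReal (Real.exp t) with he
  have hem : Measurable e := by fun_prop
  have hfin : ∀ ρ : Measure ℝ, IsFiniteMeasure ρ → (∀ᵐ t ∂ρ, t ≤ d) →
      IsFiniteMeasure (ρ.withDensity e) := by
    intro ρ hρ hd
    refine isFiniteMeasure_withDensity_ofReal (Integrable.hasFiniteIntegral ?_)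
    refine (integrable_const (Real.exp d)).mono' (by fun_prop) ?_
    filter_upwards [hd] with t ht
    rw [Real.norm_of_nonneg (Real.exp_nonneg _)]
    gcongr
  have hchar : ∀ (ρ : Measure ℝ) (u : ℝ), charFun (ρ.withDensity e) u =
      ∫ t, Complex.exp ((1 + u * Complex.I) * (t : ℝ)) ∂ρ := by
    intro ρ u
    rw [charFun_apply_real, integral_withDensity_eq_integral_toReal_smul hem
      (ae_of_all _ fun _ => ENNReal.ofReal_lt_top)]
    congr 1
    funext t
    rw [he, ENNReal.toReal_ofReal (Real.exp_nonneg _), Complex.real_smul, Complex.ofReal_exp,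
      ← Complex.exp_add]
    ring_nf
  have := hfin μ inferInstance hμ
  have := hfin ν inferInstance hν
  have heq : μ.withDensity e = ν.withDensity e := by
    refine Measure.ext_of_charFun (funext fun u => ?_)
    rw [hchar, hchar, h _ (by simp)]
  have hinv : ∀ ρ : Measure ℝ, (ρ.withDensity e).withDensity (fun x => (e x)⁻¹) = ρ := fun ρ =>
    withDensity_inv_same hem (ae_of_all _ fun t => by simp [he, Real.exp_pos])
      (ae_of_all _ fun _ => ENNReal.ofReal_ne_top)
  rw [← hinv μ, heq, hinv ν]

/-- A measure bounded above is determined by its generalized Stieltjes transform. -/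
lemma MeasureTheory.Measure.ext_of_integral_sub_rpow [IsFiniteMeasure μ] [IsFiniteMeasure ν]
    (hμ : ∀ᵐ t ∂μ, t ≤ d) (hν : ∀ᵐ t ∂ν, t ≤ d) (hs : 0 < s)
    (h : ∀ x : ℝ, d < x → ∫ t, (x - t) ^ (-s) ∂μ = ∫ t, (x - t) ^ (-s) ∂ν) : μ = ν := by
  refine Measure.ext_of_integral_exp hμ hν fun y hy => ?_
  have hΦ := differentiableOn_integral_sub_cpow hμ hs
  have hx := fun x (hx : d < x) => integral_sub_cpow_ofReal (s := s) hμ hx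
  rw [integral_exp_eq_hankelInt hμ hs (lt_add_one d) one_pos hy hΦ hx,
    integral_exp_eq_hankelInt hν hs (lt_add_one d) one_pos hy hΦ fun x hd => by
      rw [hx x hd, h x hd]]

end Stieltjes

lemma lintegral_dirichletMean_zero {θ : ℝ} (hθ : 0 < θ) (b : Fin 1 → ℝ) {f : ℝ → ℝ≥0∞}
    (hf : Measurable f) : ∫⁻ t, f t ∂dirichletMean θ b = f (b 0) := by
  have h1 := dirichletMean_univ hθ b
  rw [← lintegral_one, lintegral_dirichletMean θ b measurable_const] at h1
  have h2 : ∀ v : Fin 0 → ℝ, baryMean b v = b 0 := fun v => by simp [baryMean]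
  rw [lintegral_dirichletMean θ b hf]
  simp_rw [h2]
  rw [lintegral_mul_const _ (measurable_dirichletDens θ 0).ennreal_ofReal, ← mul_assoc]
  simp only [mul_one] at h1
  rw [h1, one_mul]

lemma lintegral_bottomLaw_zero {θ : ℝ} (hθ : 0 < θ) (b : Fin 1 → ℝ) {f : ℝ → ℝ≥0∞}
    (hf : Measurable f) : ∫⁻ t, f t ∂bottomLaw θ b = f (b 0) := by
  have hc : obpConst θ 0 = 1 := by simp [obpConst, (Real.Gamma_pos_of_pos hθ).ne']
  have hv : vdm b = 1 := by simp [vdm]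
  have hd : obpDomain b = Set.univ := by
    ext x
    simp [obpDomain]
  have hw : ∀ x, obpWt θ b x = 1 := fun x => by simp [obpWt]
  have hl : ∀ x, lvl b x 0 (Nat.succ_pos 0) 0 = b 0 := fun x => by rw [lvl_top]
  rw [lintegral_bottomLaw θ b hf, hc, hv, hd]
  simp only [hw, hl]
  simp [volume_pi]

/-- The bottom particle of the orbital beta process has the law of a Dirichlet mean. -/
theorem bottomLaw_eq_dirichletMean {θ : ℝ} (hθ : 0 < θ) {n : ℕ} {b : Fin (n + 1) → ℝ}
    (hb : StrictAnti b) : bottomLaw θ b = dirichletMean θ b := by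
  induction n with
  | zero =>
    refine Measure.ext_of_lintegral _ fun f hf => ?_
    rw [lintegral_bottomLaw_zero hθ b hf, lintegral_dirichletMean_zero hθ b hf]
  | succ n ih =>
    have hrec : ∀ {f : ℝ → ℝ≥0∞}, Measurable f → ∫⁻ t, f t ∂bottomLaw θ b =
        ENNReal.ofReal (dirichletConst θ (n + 1)) * ∫⁻ a in {a | Interlaces a b},
          ENNReal.ofReal (daDens θ b a) * ∫⁻ t, f t ∂dirichletMean θ a := by
      intro f hf
      rw [lintegral_bottomLaw_succ hθ hb hf]
      congr 1
      refine setLIntegral_congr_fun (isOpen_interlaces b).measurableSet fun a ha => ?_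
      rw [ih (Interlaces.strictAnti hb ha)]
    have h0 : ∀ a : Fin (n + 1) → ℝ, Interlaces a b → a 0 < b 0 := fun a ha => (ha 0).1
    have hfin : bottomLaw θ b Set.univ = 1 := by
      rw [← lintegral_one, hrec measurable_const]
      simp only [lintegral_one, dirichletMean_univ hθ, mul_one]
      exact lintegral_daDens_one hθ hb
    have : IsFiniteMeasure (bottomLaw θ b) := ⟨by simp [hfin]⟩
    have : IsFiniteMeasure (dirichletMean θ b) := ⟨by simp [dirichletMean_univ hθ]⟩
    have hd : ∀ᵐ t ∂dirichletMean θ b, t ≤ b 0 :=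
      (ae_dirichletMean_mem_Icc θ hb).mono fun t ht => ht.2
    have hbt : ∀ᵐ t ∂bottomLaw θ b, t ≤ b 0 := by
      rw [ae_iff]
      simp only [not_le]
      change bottomLaw θ b (Set.Ioi (b 0)) = 0
      rw [← lintegral_indicator_one measurableSet_Ioi,
        hrec (measurable_one.indicator measurableSet_Ioi)]
      refine mul_eq_zero_of_right _ ?_
      rw [setLIntegral_congr_fun (g := fun _ => 0) (isOpen_interlaces b).measurableSet, lintegral_zero]
      intro a ha
      refine mul_eq_zero_of_right _ ?_
      rw [lintegral_indicator_one measurableSet_Ioi]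
      have h1 := (ae_dirichletMean_mem_Icc θ (Interlaces.strictAnti hb ha))
      refine measure_mono_null (t := {t | ¬ t ∈ Set.Icc (a (Fin.last n)) (a 0)}) ?_ (ae_iff.1 h1)
      intro t ht hmem
      exact absurd (hmem.2.trans_lt (h0 a ha)) (not_lt.2 (le_of_lt ht))
    have hs : 0 < (n + 1) * θ := by positivity
    refine Measure.ext_of_integral_sub_rpow hbt hd hs fun x hx => ?_
    have hm : Measurable fun t : ℝ => (x - t) ^ (-((n + 1) * θ)) := by fun_prop
    rw [integral_eq_lintegral_of_nonneg_ae ?_ hm.aestronglyMeasurable,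
      integral_eq_lintegral_of_nonneg_ae ?_ hm.aestronglyMeasurable]
    · have h1 := lintegral_daDens_prod_sub (θ := θ) hb hx
      push_cast at h1
      rw [← h1, hrec hm.ennreal_ofReal]
      congr 2
      refine setLIntegral_congr_fun (isOpen_interlaces b).measurableSet fun a ha => ?_
      rw [lintegral_sub_rpow_dirichletMean hθ (Interlaces.strictAnti hb ha) ((h0 a ha).trans hx)]
    · filter_upwards [hd] with t ht using Real.rpow_nonneg (by linarith) _
    · filter_upwards [hbt] with t ht using Real.rpow_nonneg (by linarith) _

lemma sumLvl_one {n : ℕ} (a : Fin (n + 1) → ℝ) (x : Tri n) :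
    sumLvl a x 1 = lvl a x 0 n.succ_pos 0 := by
  by_cases h : 0 < n
  · rw [sumLvl, lvl, if_neg one_ne_zero, dif_pos (by exact h), dif_pos (by exact h)]
    exact Fin.sum_univ_one _
  · obtain rfl : n = 0 := by omega
    simp [sumLvl, lvl]

lemma MBF_eq_integral_bottomLaw {θ : ℝ} (hθ : 0 < θ) {n : ℕ} {a : Fin (n + 1) → ℝ}
    (ha : StrictAnti a) (y : ℂ) :
    MBF θ a (fun k => if k.1 = 0 then y else 0) =
      ∫ t, Complex.exp (y * (t : ℝ)) ∂bottomLaw θ a := by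
  have hV := vdm_pos ha.injective
  have hc := obpConst_pos hθ n
  have h1 : ∀ x : Tri n, ∑ k : Fin (n + 1), (if k.1 = 0 then y else 0) *
      ((sumLvl a x (k.1 + 1) - sumLvl a x k.1 : ℝ) : ℂ) = y * (lvl a x 0 n.succ_pos 0 : ℝ) := by
    intro x
    rw [Finset.sum_eq_single 0 (fun k _ hk => by simp [Fin.val_ne_zero_iff.2 hk]) (by simp)]
    simp only [Fin.val_zero, if_true, zero_add, sumLvl_one]
    simp [sumLvl]
  have hm : AEStronglyMeasurable (fun t : ℝ => Complex.exp (y * (t : ℝ)))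
      (((volume.restrict (obpDomain a)).withDensity fun x => ENNReal.ofReal (obpWt θ a x)).map
      fun x => lvl a x 0 n.succ_pos 0) :=
    (by fun_prop : Continuous fun t : ℝ => Complex.exp (y * (t : ℝ))).aestronglyMeasurable
  rw [bottomLaw, integral_smul_measure, integral_map (measurable_lvl a 0 _ 0).aemeasurable hm,
    integral_withDensity_eq_integral_toReal_smul (measurable_obpWt θ a).ennreal_ofReal
      (ae_of_all _ fun _ => ENNReal.ofReal_lt_top), ENNReal.toReal_ofReal (by positivity),
    Complex.real_smul, MBF, vdm_rpow, Complex.ofReal_mul]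
  refine congrArg₂ _ rfl (integral_congr_ae (ae_of_all _ fun x => ?_))
  simp only
  rw [h1 x, ENNReal.toReal_ofReal (obpWt_nonneg θ a x), Complex.real_smul, mul_comm]

/-- The function `∏ i, (z - a i) ^ (-θ)`, cut along the half-line to the left of the nodes. -/
def prodPow (θ : ℝ) {N : ℕ} (a : Fin N → ℝ) (z : ℂ) : ℂ :=
  ∏ i : Fin N, Complex.exp (-(θ : ℂ) * Complex.log (z - (a i : ℂ)))

section prodPow

variable {θ : ℝ} {n : ℕ} {a : Fin (n + 1) → ℝ}

lemma differentiableOn_prodPow (θ : ℝ) (ha : StrictAnti a) :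
    DifferentiableOn ℂ (prodPow θ a) (slitAt (a 0)) := by
  intro z hz
  refine DifferentiableAt.differentiableWithinAt ?_
  refine DifferentiableAt.fun_finsetProd fun i _ => ?_
  have hz' : z - a i ∈ Complex.slitPlane := slitAt_subset (ha.antitone (Fin.zero_le i)) hz
  exact ((((differentiableAt_id.sub_const _).clog hz').const_mul _).cexp)

lemma prodPow_ofReal (ha : StrictAnti a) {x : ℝ} (hx : a 0 < x) :
    prodPow θ a x = ((∏ i, (x - a i) ^ (-θ) : ℝ) : ℂ) := by
  rw [prodPow, Complex.ofReal_prod]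
  refine Finset.prod_congr rfl fun i _ => ?_
  have hi : 0 < x - a i := by linarith [ha.antitone (Fin.zero_le i)]
  rw [Real.rpow_def_of_pos hi, Complex.ofReal_exp, ← Complex.ofReal_sub,
    ← Complex.ofReal_log hi.le]
  push_cast
  ring_nf

lemma norm_prodPow_le (hθ : 0 < θ) (a : Fin (n + 1) → ℝ) {r : ℝ} (hr : 0 < r) {z : ℂ}
    (hz : |z.im| = r) : ‖prodPow θ a z‖ ≤ (r ^ (-θ)) ^ (n + 1) := by
  rw [prodPow, norm_prod]
  refine (Finset.prod_le_prod (fun _ _ => norm_nonneg _) fun i _ => ?_).trans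
    (by simp : ∏ _i : Fin (n + 1), r ^ (-θ) ≤ _)
  have h0 : z - a i ≠ 0 := fun h => by
    have := congrArg Complex.im h
    simp only [Complex.sub_im, Complex.ofReal_im, sub_zero, Complex.zero_im] at this
    simp [this] at hz
    linarith
  rw [mul_comm, ← Complex.cpow_def_of_ne_zero h0]
  exact norm_sub_cpow_le hθ hr hz.ge

end prodPow

/-- (Theorem 5.1) Contour integral representation of
`𝓑_a(y, 0^{N-1}; θ)` for `Re y > 0`, over the counter-clockwise contour consisting of
the ray from `-∞ - ri` to `M - ri`, the segment from `M - ri` to `M + ri` and the ray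
from `M + ri` to `-∞ + ri`, with `M > a₁`. -/
theorem mbf_contour_left
    (θ : ℝ) (hθ : 0 < θ) (N : ℕ) (hN : 1 ≤ N)
    (a : Fin N → ℝ) (ha : StrictAnti a)
    (y : ℂ) (hy : 0 < y.re) (M r : ℝ) (hM : a ⟨0, by omega⟩ < M) (hr : 0 < r) :
    IntegrableOn (fun t : ℝ => contourFnL θ a y (t - r * Complex.I)) (Set.Iic M)
        volume ∧
    IntegrableOn (fun t : ℝ => contourFnL θ a y (t + r * Complex.I)) (Set.Iic M)
        volume ∧
    MBF θ a (fun k => if k.1 = 0 then y else 0) =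
      ((Real.Gamma (θ * N) : ℂ) /
          Complex.exp (((θ * N - 1 : ℝ) : ℂ) * Complex.log y)) *
        (2 * (Real.pi : ℂ) * Complex.I)⁻¹ *
        ((∫ t in Set.Iic M, contourFnL θ a y (t - r * Complex.I)) +
          Complex.I * (∫ s in (-r)..r, contourFnL θ a y (M + s * Complex.I)) -
          ∫ t in Set.Iic M, contourFnL θ a y (t + r * Complex.I)) := by
  obtain ⟨n, rfl⟩ : ∃ n, N = n + 1 := ⟨N - 1, by omega⟩
  have ha0 : a 0 < M := hM
  have hs : 0 < (n + 1) * θ := by positivity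
  have hreg : HankelRegular (prodPow θ a) M r ((r ^ (-θ)) ^ (n + 1)) :=
    (differentiableOn_prodPow θ ha).continuousOn.hankelRegular hr ha0
      fun z hz => norm_prodPow_le hθ a hr hz
  have hsub : ∀ t : ℝ, (t - r * Complex.I : ℂ) = t + ((-r : ℝ) : ℂ) * Complex.I := fun t => by
    push_cast
    ring
  refine ⟨?_, hreg.integrableOn_ray hy hreg.abs_eq, ?_⟩
  · simp only [hsub]
    exact hreg.integrableOn_ray hy hreg.abs_neg_eq
  have : IsFiniteMeasure (dirichletMean θ a) := ⟨by simp [dirichletMean_univ hθ]⟩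
  have hd : ∀ᵐ t ∂dirichletMean θ a, t ≤ a 0 :=
    (ae_dirichletMean_mem_Icc θ ha).mono fun t ht => ht.2
  have htr : ∀ x : ℝ, a 0 < x → prodPow θ a x =
      ((∫ t, (x - t) ^ (-((n + 1) * θ)) ∂dirichletMean θ a : ℝ) : ℂ) := by
    intro x hx
    have hm : Measurable fun t : ℝ => (x - t) ^ (-((n + 1) * θ)) := by fun_prop
    have hnn : 0 ≤ ∏ i, (x - a i) ^ (-θ) := Finset.prod_nonneg fun i _ =>
      Real.rpow_nonneg (by linarith [ha.antitone (Fin.zero_le i)]) _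
    rw [prodPow_ofReal ha hx, integral_eq_lintegral_of_nonneg_ae ?_ hm.aestronglyMeasurable,
      lintegral_sub_rpow_dirichletMean hθ ha hx, ENNReal.toReal_ofReal hnn]
    filter_upwards [hd] with t ht using Real.rpow_nonneg (by linarith) _
  have hy0 : y ≠ 0 := fun h => by simp [h] at hy
  have hexp : Complex.exp (((θ * (n + 1 : ℕ) - 1 : ℝ) : ℂ) * Complex.log y) =
      y ^ (((n + 1) * θ - 1 : ℝ) : ℂ) := by
    rw [Complex.cpow_def_of_ne_zero hy0]
    push_cast
    ring_nf
  have hΓ : Real.Gamma (θ * (n + 1 : ℕ)) = Real.Gamma ((n + 1) * θ) := by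
    push_cast
    rw [mul_comm]
  simp only [hsub]
  rw [MBF_eq_integral_bottomLaw hθ ha, bottomLaw_eq_dirichletMean hθ ha,
    integral_exp_eq_hankelInt hd hs ha0 hr hy (differentiableOn_prodPow θ ha) htr, hexp, hΓ]
  rfl

end
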